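/- arXiv:2202.10257 — 3 statements merged into one kernel-verified Lean document; each statement's English description precedes it below -/
import Mathlib

section
/- For any prime p and integers n, d ≥ 1, the number of complete flags 0 = A₀ ⊊ A₁ ⊊ ⋯ ⊊ A_d = (ℤ/p^nℤ)^d, where each A_i is a free ℤ/p^nℤ-submodule of rank i, equals p^{d(d+1)n/2} / φ(p^n)^d · ∏_{j=1}^{d} (1 − p^{−j}), where φ(p^n) = p^n − p^{n−1}. -/
open Module

section abstract
variable {R : Type} [CommRing R] [IsLocalRing R] [Finite R]

def FR {M : Type} [AddCommGroup M] [Module R M] (A : Submodule R M) (k : ℕ) : Prop :=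
  Module.Free R A ∧ Module.finrank R A = k

theorem fr_card {M : Type} [AddCommGroup M] [Module R M] [Finite M] {A : Submodule R M} {k : ℕ}
    (h : FR A k) : Nat.card A = Nat.card R ^ k := by
  obtain ⟨h1, h2⟩ := h
  have e := (Module.finBasisOfFinrankEq R A h2).equivFun
  rw [Nat.card_congr e.toEquiv]
  simp [Nat.card_fun]

theorem fr_zero {M : Type} [AddCommGroup M] [Module R M] [Finite M] {A : Submodule R M} :
    FR A 0 ↔ A = ⊥ := by
  constructor
  · intro h
    have := fr_card h
    rw [pow_zero, Nat.card_eq_one_iff_unique] at this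
    have := this.1
    exact Submodule.eq_bot_of_subsingleton
  · rintro rfl
    exact ⟨inferInstance, by simp⟩

noncomputable def splitEquiv {M : Type} [AddCommGroup M] [Module R M] (v : M) (f : M →ₗ[R] R)
    (hf : f v = 1) (A : Submodule R M) (hv : v ∈ A) :
    A ≃ₗ[R] R × (A.map (R ∙ v).mkQ) :=
  LinearEquiv.ofBijective
    ((f ∘ₗ A.subtype).prod
      (((R ∙ v).mkQ ∘ₗ A.subtype).codRestrict (A.map (R ∙ v).mkQ) (fun a => Submodule.mem_map_of_mem a.2))) <| by
    constructor
    · rw [← LinearMap.ker_eq_bot, Submodule.eq_bot_iff]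
      rintro ⟨a, ha⟩ h
      have h1 : f a = 0 := congrArg Prod.fst h
      have h2 := congrArg Prod.snd h
      have h2' : (R ∙ v).mkQ a = 0 := congrArg Subtype.val h2
      rw [Submodule.mkQ_apply, Submodule.Quotient.mk_eq_zero, Submodule.mem_span_singleton] at h2'
      obtain ⟨r, rfl⟩ := h2'
      simp [hf] at h1
      simp [h1]
    · rintro ⟨r, ⟨w, hw⟩⟩
      obtain ⟨a, ha, rfl⟩ := Submodule.mem_map.1 hw
      refine ⟨⟨a + (r - f a) • v, A.add_mem ha (A.smul_mem _ hv)⟩, ?_⟩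
      refine Prod.ext ?_ (Subtype.ext ?_)
      · simp [hf]
      · change (R ∙ v).mkQ (a + (r - f a) • v) = (R ∙ v).mkQ a
        rw [map_add, map_smul]
        have : (R ∙ v).mkQ v = 0 := by
          rw [Submodule.mkQ_apply, Submodule.Quotient.mk_eq_zero]
          exact Submodule.mem_span_singleton_self v
        simp [this]

theorem fr_split {M : Type} [AddCommGroup M] [Module R M] [Finite M] (v : M) (f : M →ₗ[R] R)
    (hf : f v = 1) (A : Submodule R M) (hv : v ∈ A) (k : ℕ) :
    FR A (k + 1) ↔ FR (A.map (R ∙ v).mkQ) k := by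
  have e := splitEquiv v f hf A hv
  constructor
  · rintro ⟨h1, h2⟩
    have : Module.Projective R (A.map (R ∙ v).mkQ) :=
      Module.Projective.of_split (M := A) (e.symm.toLinearMap ∘ₗ LinearMap.inr R _ _)
        (LinearMap.snd R _ _ ∘ₗ e.toLinearMap) (by ext; simp)
    have hfree : Module.Free R (A.map (R ∙ v).mkQ) := Module.free_of_flat_of_isLocalRing
    refine ⟨hfree, ?_⟩
    rw [e.finrank_eq, Module.finrank_prod, Module.finrank_self] at h2
    omega
  · rintro ⟨h1, h2⟩
    refine ⟨Module.Free.of_equiv e.symm, ?_⟩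
    rw [e.finrank_eq, Module.finrank_prod, Module.finrank_self]
    omega

theorem fr_top {M : Type} [AddCommGroup M] [Module R M] (k : ℕ) :
    FR (⊤ : Submodule R M) k ↔ (Module.Free R M ∧ Module.finrank R M = k) := by
  unfold FR
  rw [finrank_top]
  constructor
  · rintro ⟨h1, h2⟩
    exact ⟨Module.Free.of_equiv Submodule.topEquiv, h2⟩
  · rintro ⟨h1, h2⟩
    exact ⟨Module.Free.of_equiv Submodule.topEquiv.symm, h2⟩

def Uni (R : Type) [CommRing R] (M : Type) [AddCommGroup M] [Module R M] : Type :=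
  {v : M // ∀ r : R, r • v = 0 → r = 0}

theorem uni_iff (s : R) (hs0 : s ≠ 0) (hs : ∀ x : R, ¬ IsUnit x → s * x = 0)
    {M : Type} [AddCommGroup M] [Module R M] {k : ℕ} (b : Basis (Fin k) R M) (v : M) :
    (∀ r : R, r • v = 0 → r = 0) ↔ ∃ i, IsUnit (b.repr v i) := by
  constructor
  · intro h
    by_contra hc
    push Not at hc
    refine hs0 (h s (b.repr.injective ?_))
    ext i
    simp [hs _ (hc i)]
  · rintro ⟨i, hi⟩ r hr
    have : b.repr (r • v) i = 0 := by simp [hr]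
    rw [map_smul, Finsupp.smul_apply, smul_eq_mul] at this
    exact (hi.mul_left_eq_zero).1 this

theorem uni_fun (s : R) (hs0 : s ≠ 0) (hs : ∀ x : R, ¬ IsUnit x → s * x = 0)
    {M : Type} [AddCommGroup M] [Module R M] {k : ℕ} (b : Basis (Fin k) R M) (v : M)
    (h : ∀ r : R, r • v = 0 → r = 0) : ∃ f : M →ₗ[R] R, f v = 1 := by
  obtain ⟨i, u, hu⟩ := (uni_iff s hs0 hs b v).1 h
  refine ⟨(↑u⁻¹ : R) • b.coord i, ?_⟩
  simp [← hu]

theorem card_uni (s : R) (hs0 : s ≠ 0) (hs : ∀ x : R, ¬ IsUnit x → s * x = 0)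
    {M : Type} [AddCommGroup M] [Module R M] {k : ℕ} (b : Basis (Fin k) R M) :
    Nat.card (Uni R M) + Nat.card {x : R // ¬ IsUnit x} ^ k = Nat.card R ^ k := by
  classical
  have e1 : Uni R M ≃ {w : Fin k → R // ¬ ∀ i, ¬ IsUnit (w i)} :=
    b.equivFun.toEquiv.subtypeEquiv (fun v => by
      rw [uni_iff s hs0 hs b v]; simp)
  have e2 : {w : Fin k → R // ∀ i, ¬ IsUnit (w i)} ≃ (Fin k → {x : R // ¬ IsUnit x}) :=
    Equiv.subtypePiEquivPi (p := fun (_ : Fin k) (x : R) => ¬ IsUnit x)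
  have h2 := Nat.card_congr e2
  rw [Nat.card_fun, Nat.card_fin] at h2
  rw [Nat.card_congr e1, ← h2, add_comm, ← Nat.card_sum,
    Nat.card_congr (Equiv.sumCompl (fun w : Fin k → R => ∀ i, ¬ IsUnit (w i))), Nat.card_fun,
    Nat.card_fin]

def Lines (R : Type) [CommRing R] (M : Type) [AddCommGroup M] [Module R M] : Type :=
  {L : Submodule R M // FR L 1}

theorem line_gen {M : Type} [AddCommGroup M] [Module R M] [Finite M]
    (L : Submodule R M) (h : FR L 1) :
    ∃ v : M, (∀ r : R, r • v = 0 → r = 0) ∧ L = R ∙ v := by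
  obtain ⟨h1, h2⟩ := h
  let b := Module.finBasisOfFinrankEq R L h2
  refine ⟨b 0, ?_, ?_⟩
  · intro r hr
    have hr' : r • b 0 = 0 := Subtype.ext hr
    have : b.repr (r • b 0) 0 = 0 := by rw [hr']; simp
    simpa using this
  · apply le_antisymm
    · intro x hx
      have := b.sum_repr ⟨x, hx⟩
      rw [Submodule.mem_span_singleton]
      refine ⟨b.repr ⟨x, hx⟩ 0, ?_⟩
      rw [Fin.sum_univ_one] at this
      exact congrArg Subtype.val this
    · rw [Submodule.span_singleton_le_iff_mem]
      exact (b 0).2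

theorem fr_span {M : Type} [AddCommGroup M] [Module R M]
    (v : M) (h : ∀ r : R, r • v = 0 → r = 0) : FR (R ∙ v) 1 := by
  have e : R ≃ₗ[R] (R ∙ v) := (LinearEquiv.ofInjective (LinearMap.toSpanSingleton R M v) (by
    rw [← LinearMap.ker_eq_bot, Submodule.eq_bot_iff]
    intro r hr
    exact h r (by simpa using hr))).trans
      (LinearEquiv.ofEq _ _ (LinearMap.range_toSpanSingleton v))
  exact ⟨Module.Free.of_equiv e, by rw [← e.finrank_eq, Module.finrank_self]⟩

theorem card_lines {M : Type} [AddCommGroup M] [Module R M] [Finite M] :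
    Nat.card (Lines R M) * Nat.card Rˣ = Nat.card (Uni R M) := by
  classical
  rw [← Nat.card_prod]
  choose g hg hL using fun L : Lines R M => line_gen L.1 L.2
  refine Nat.card_congr (Equiv.ofBijective
    (fun x : Lines R M × Rˣ => (⟨(x.2 : R) • g x.1, fun r hr => ?_⟩ : Uni R M)) ⟨?_, ?_⟩)
  · rw [smul_smul] at hr
    exact (x.2.isUnit.mul_left_eq_zero).1 (hg x.1 _ hr)
  · rintro ⟨L, u⟩ ⟨L', u'⟩ h
    have h' : (u : R) • g L = (u' : R) • g L' := congrArg Subtype.val h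
    have key : ∀ (L : Lines R M) (u : Rˣ), L.1 = R ∙ ((u : R) • g L) := fun L u => by
      rw [Submodule.span_singleton_smul_eq u.isUnit, ← hL]
    have hLL : L = L' := Subtype.ext (by rw [key L u, key L' u', h'])
    subst hLL
    have : ((u : R) - u') = 0 := hg L _ (by rw [sub_smul, h', sub_self])
    rw [sub_eq_zero] at this
    rw [Units.ext this]
  · rintro ⟨v, hv⟩
    let L : Lines R M := ⟨R ∙ v, fr_span v hv⟩
    have h1 : v ∈ R ∙ g L := by
      rw [← hL L]; exact Submodule.mem_span_singleton_self v
    have h2 : g L ∈ R ∙ v := by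
      change g L ∈ L.1
      rw [hL L]; exact Submodule.mem_span_singleton_self _
    rw [Submodule.mem_span_singleton] at h1 h2
    obtain ⟨a, ha⟩ := h1
    obtain ⟨c, hc⟩ := h2
    have : a * c = 1 := by
      rw [← sub_eq_zero]
      apply hv
      rw [sub_smul, mul_smul, hc, ha, one_smul, sub_self]
    exact ⟨(L, ⟨a, c, this, by rw [mul_comm]; exact this⟩), Subtype.ext ha⟩

def Flags (R : Type) [CommRing R] (M : Type) [AddCommGroup M] [Module R M] (d : ℕ) : Type :=
  {A : Fin (d + 1) → Submodule R M // Monotone A ∧ ∀ i : Fin (d + 1), FR (A i) i}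

instance {M : Type} [AddCommGroup M] [Module R M] [Finite M] (d : ℕ) : Finite (Flags R M d) := by
  unfold Flags; infer_instance

instance {M : Type} [AddCommGroup M] [Module R M] [Finite M] : Finite (Lines R M) := by
  unfold Lines; infer_instance

def firstLine {M : Type} [AddCommGroup M] [Module R M] {d : ℕ} (A : Flags R M (d + 1)) :
    Lines R M := ⟨A.1 1, by simpa using A.2.2 1⟩

def fiberEquiv {M : Type} [AddCommGroup M] [Module R M] [Finite M] {d : ℕ}
    (v : M) [Finite (M ⧸ (R ∙ v))] (f : M →ₗ[R] R) (hf : f v = 1) (L : Lines R M) (hL : L.1 = R ∙ v) :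
    {A : Flags R M (d + 1) // firstLine A = L} ≃ Flags R (M ⧸ (R ∙ v)) d where
  toFun A := ⟨fun i => (A.1.1 i.succ).map (R ∙ v).mkQ,
    fun i j h => Submodule.map_mono (A.1.2.1 (Fin.succ_le_succ_iff.2 h)), fun i => by
      rw [← fr_split v f hf]
      · simpa using A.1.2.2 i.succ
      · have h1 : A.1.1 1 = R ∙ v := (congrArg Subtype.val A.2).trans hL
        have h2 : A.1.1 1 ≤ A.1.1 i.succ := A.1.2.1 (by simp [Fin.le_def])
        exact h2 (h1 ▸ Submodule.mem_span_singleton_self v)⟩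
  invFun B := ⟨⟨Fin.cons ⊥ (fun i => (B.1 i).comap (R ∙ v).mkQ), by
      intro i j h
      refine Fin.cases ?_ (fun i h => ?_) i h
      · simp
      · revert h
        refine Fin.cases ?_ (fun j h => ?_) j
        · intro h; simp [Fin.le_def] at h
        · simpa using Submodule.comap_mono (B.2.1 (Fin.succ_le_succ_iff.1 h)), fun i => by
      refine Fin.cases ?_ (fun i => ?_) i
      · simpa using fr_zero.2 rfl
      · have : FR ((B.1 i).comap (R ∙ v).mkQ) (i + 1) := by
          rw [fr_split v f hf, Submodule.map_comap_eq_of_surjective (Submodule.mkQ_surjective _)]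
          · exact B.2.2 i
          · exact Submodule.le_comap_mkQ (R ∙ v) _ (Submodule.mem_span_singleton_self v)
        simpa using this⟩, by
      apply Subtype.ext
      have h0 : B.1 0 = ⊥ := fr_zero.1 (by simpa using B.2.2 0)
      change (Fin.cons ⊥ (fun i => (B.1 i).comap (R ∙ v).mkQ) : Fin (d + 2) → _) (Fin.succ 0) = _
      rw [Fin.cons_succ, h0, hL]
      simp⟩
  left_inv A := by
    apply Subtype.ext
    apply Subtype.ext
    funext i
    refine Fin.cases ?_ (fun i => ?_) i
    · have : A.1.1 0 = ⊥ := fr_zero.1 (by simpa using A.1.2.2 0)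
      simp [this]
    · have h1 : A.1.1 1 = R ∙ v := (congrArg Subtype.val A.2).trans hL
      have h2 : A.1.1 1 ≤ A.1.1 i.succ := A.1.2.1 (by simp [Fin.le_def])
      simp only [Fin.cons_succ]
      rw [Submodule.comap_map_mkQ, ← h1]
      exact sup_eq_right.2 h2
  right_inv B := by
    apply Subtype.ext
    funext i
    simp only [Fin.cons_succ]
    exact Submodule.map_comap_eq_of_surjective (Submodule.mkQ_surjective _) _

theorem card_flags (s : R) (hs0 : s ≠ 0) (hs : ∀ x : R, ¬ IsUnit x → s * x = 0) (d : ℕ) :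
    ∀ (M : Type) [AddCommGroup M] [Module R M] [Finite M],
      Module.Free R M → Module.finrank R M = d →
      (Nat.card (Flags R M d) : ℚ) * (Nat.card Rˣ : ℚ) ^ d =
        ∏ j ∈ Finset.Icc 1 d,
          ((Nat.card R : ℚ) ^ j - (Nat.card {x : R // ¬ IsUnit x} : ℚ) ^ j) := by
  induction d with
  | zero =>
    intro M _ _ _ h1 h2
    have : Nat.card (Flags R M 0) = 1 := by
      rw [Nat.card_eq_one_iff_unique]
      constructor
      · constructor
        intro A B
        apply Subtype.ext
        funext i
        rw [Fin.fin_one_eq_zero i, fr_zero.1 (A.2.2 0), fr_zero.1 (B.2.2 0)]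
      · exact ⟨fun _ => ⊥, fun _ _ _ => le_rfl, fun i => by
          rw [Fin.fin_one_eq_zero i]; exact fr_zero.2 rfl⟩
    simp [this]
  | succ d ih =>
    intro M _ _ _ h1 h2
    classical
    let b := Module.finBasisOfFinrankEq R M h2
    have := Fintype.ofFinite (Lines R M)
    have hU := card_uni s hs0 hs b
    rw [← card_lines] at hU
    have hU' : (Nat.card (Lines R M) : ℚ) * Nat.card Rˣ = (Nat.card R : ℚ) ^ (d + 1)
        - (Nat.card {x : R // ¬ IsUnit x} : ℚ) ^ (d + 1) := by
      rw [eq_sub_iff_add_eq]; exact_mod_cast hU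
    rw [← Nat.card_congr (Equiv.sigmaFiberEquiv (firstLine (R := R) (M := M) (d := d))),
      Nat.card_sigma, Nat.cast_sum, Finset.sum_mul, Finset.prod_Icc_succ_top (by omega), ← hU']
    have key : ∀ L : Lines R M,
        (Nat.card {A : Flags R M (d + 1) // firstLine A = L} : ℚ) * (Nat.card Rˣ : ℚ) ^ (d + 1)
        = (∏ j ∈ Finset.Icc 1 d,
          ((Nat.card R : ℚ) ^ j - (Nat.card {x : R // ¬ IsUnit x} : ℚ) ^ j)) * Nat.card Rˣ := by
      intro L
      obtain ⟨v, hv, hL⟩ := line_gen L.1 L.2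
      obtain ⟨f, hf⟩ := uni_fun s hs0 hs b v hv
      have ht := (fr_split v f hf ⊤ trivial d).1 ((fr_top _).2 ⟨h1, h2⟩)
      rw [Submodule.map_top, Submodule.range_mkQ, fr_top] at ht
      have : Finite (M ⧸ (R ∙ v)) := Finite.of_surjective _ (Submodule.mkQ_surjective (R ∙ v))
      rw [Nat.card_congr (fiberEquiv v f hf L hL), ← ih _ ht.1 ht.2]
      ring
    rw [Finset.sum_congr rfl (fun L _ => key L), Finset.sum_const, Finset.card_univ,
      ← Nat.card_eq_fintype_card, nsmul_eq_mul]
    ring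

end abstract

theorem zmod_not_unit {p : ℕ} (hp : p.Prime) (n : ℕ) (hn : 0 < n) (x : ZMod (p ^ n)) :
    ¬ IsUnit x ↔ ∃ y, x = p * y := by
  have : NeZero (p ^ n) := ⟨pow_ne_zero _ hp.ne_zero⟩
  constructor
  · intro h
    rw [← ZMod.natCast_zmod_val x, ZMod.isUnit_iff_coprime, Nat.coprime_pow_right_iff hn,
      Nat.coprime_comm, hp.coprime_iff_not_dvd, not_not] at h
    obtain ⟨y, hy⟩ := h
    exact ⟨y, by rw [← ZMod.natCast_zmod_val x, hy]; simp⟩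
  · rintro ⟨y, rfl⟩ h
    have := isUnit_of_mul_isUnit_left h
    rw [ZMod.isUnit_iff_coprime, Nat.coprime_pow_right_iff hn, Nat.coprime_self] at this
    exact hp.one_lt.ne' this

theorem zmod_local {p : ℕ} (hp : p.Prime) (n : ℕ) (hn : 0 < n) : IsLocalRing (ZMod (p ^ n)) := by
  have : Fact (1 < p ^ n) := ⟨Nat.one_lt_pow hn.ne' hp.one_lt⟩
  apply IsLocalRing.of_nonunits_add
  intro a b ha hb
  rw [mem_nonunits_iff, zmod_not_unit hp n hn] at *
  obtain ⟨y, rfl⟩ := ha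
  obtain ⟨z, rfl⟩ := hb
  exact ⟨y + z, by ring⟩

/-- The number of complete flags `0 = A₀ ⊆ A₁ ⊆ ⋯ ⊆ A_d = (ℤ/p^nℤ)^d`, where each `A_i` is a
free `ℤ/p^nℤ`-submodule of rank `i`, equals
`p^{d(d+1)n/2} / φ(p^n)^d · ∏_{j=1}^{d} (1 − p^{−j})`. -/
theorem card_complete_flags_zmod_pow {p : ℕ} (hp : p.Prime) (n d : ℕ) (hn : 0 < n) (hd : 0 < d) :
    (Nat.card {A : Fin (d + 1) → Submodule (ZMod (p ^ n)) (Fin d → ZMod (p ^ n)) //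
        A 0 = ⊥ ∧ A (Fin.last d) = ⊤ ∧ (∀ i j, i ≤ j → A i ≤ A j) ∧
        ∀ i : Fin (d + 1),
          Module.Free (ZMod (p ^ n)) (A i) ∧ Module.finrank (ZMod (p ^ n)) (A i) = i} : ℚ) =
      (p : ℚ) ^ (d * (d + 1) * n / 2) / ((p ^ n).totient : ℚ) ^ d *
        ∏ j ∈ Finset.Icc 1 d, (1 - ((p : ℚ) ^ j)⁻¹) := by
  have : NeZero (p ^ n) := ⟨pow_ne_zero _ hp.ne_zero⟩
  have := zmod_local hp n hn
  have hp0 : (p : ℚ) ≠ 0 := by exact_mod_cast hp.ne_zero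
  have hs0 : ((p ^ (n - 1) : ℕ) : ZMod (p ^ n)) ≠ 0 := by
    rw [Ne, ZMod.natCast_eq_zero_iff, Nat.pow_dvd_pow_iff_le_right hp.one_lt]
    omega
  have hs : ∀ x : ZMod (p ^ n), ¬ IsUnit x → ((p ^ (n - 1) : ℕ) : ZMod (p ^ n)) * x = 0 := by
    intro x hx
    obtain ⟨y, rfl⟩ := (zmod_not_unit hp n hn x).1 hx
    rw [← mul_assoc, ← Nat.cast_mul, ← pow_succ, Nat.sub_add_cancel hn, ZMod.natCast_self, zero_mul]
  have main := card_flags _ hs0 hs d (Fin d → ZMod (p ^ n)) inferInstance (by simp)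
  have hu : Nat.card (ZMod (p ^ n))ˣ = (p ^ n).totient := by
    rw [Nat.card_eq_fintype_card, ZMod.card_units_eq_totient]
  have hnu : (Nat.card {x : ZMod (p ^ n) // ¬ IsUnit x}) = p ^ (n - 1) := by
    classical
    have hu1 : Nat.card {x : ZMod (p ^ n) // IsUnit x} = Nat.card (ZMod (p ^ n))ˣ :=
      (Nat.card_congr (Equiv.ofBijective
        (fun u : (ZMod (p ^ n))ˣ => (⟨u, u.isUnit⟩ : {x : ZMod (p ^ n) // IsUnit x}))
        ⟨fun u v h => Units.ext (congrArg Subtype.val h),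
          fun ⟨_, u, hu⟩ => ⟨u, Subtype.ext hu⟩⟩)).symm
    have h1 := Nat.card_congr (Equiv.sumCompl (fun x : ZMod (p ^ n) => IsUnit x))
    rw [Nat.card_sum, hu1, hu, Nat.card_zmod,
      Nat.totient_prime_pow hp hn] at h1
    have h2 : p ^ n = p ^ (n - 1) * (p - 1) + p ^ (n - 1) := by
      obtain ⟨m, rfl⟩ : ∃ m, n = m + 1 := ⟨n - 1, by omega⟩
      obtain ⟨q, rfl⟩ : ∃ q, p = q + 1 := ⟨p - 1, by have := hp.pos; omega⟩
      simp only [Nat.add_sub_cancel]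
      ring
    omega
  have hc : Nat.card {A : Fin (d + 1) → Submodule (ZMod (p ^ n)) (Fin d → ZMod (p ^ n)) //
        A 0 = ⊥ ∧ A (Fin.last d) = ⊤ ∧ (∀ i j, i ≤ j → A i ≤ A j) ∧
        ∀ i : Fin (d + 1),
          Module.Free (ZMod (p ^ n)) (A i) ∧ Module.finrank (ZMod (p ^ n)) (A i) = i} =
      Nat.card (Flags (ZMod (p ^ n)) (Fin d → ZMod (p ^ n)) d) := by
    refine Nat.card_congr (Equiv.subtypeEquivRight fun A => ?_)
    constructor
    · rintro ⟨-, -, h1, h2⟩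
      exact ⟨h1, h2⟩
    · rintro ⟨h1, h2⟩
      refine ⟨fr_zero.1 (by simpa using h2 0), ?_, h1, h2⟩
      have h3 := fr_card (h2 (Fin.last d))
      have h4 : Nat.card (Fin d → ZMod (p ^ n)) = Nat.card (ZMod (p ^ n)) ^ d := by
        simp [Nat.card_fun]
      rw [Fin.val_last, ← h4] at h3
      rw [← SetLike.coe_set_eq, Submodule.top_coe]
      exact (Set.eq_univ_iff_ncard _).2 h3
  rw [hc]
  have ht : ((p ^ n).totient : ℚ) ^ d ≠ 0 := by
    apply pow_ne_zero
    exact_mod_cast (Nat.totient_pos.2 (pow_pos hp.pos n)).ne'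
  rw [div_mul_eq_mul_div, eq_div_iff ht, ← hu, main, hnu, Nat.card_zmod]
  have hsum : d * (d + 1) * n / 2 = ∑ j ∈ Finset.Icc 1 d, n * j := by
    rw [← Finset.mul_sum]
    have : ∀ d : ℕ, (∑ j ∈ Finset.Icc 1 d, j) * 2 = d * (d + 1) := by
      intro d
      induction d with
      | zero => simp
      | succ d ih => rw [Finset.sum_Icc_succ_top (by omega), add_mul, ih]; ring
    rw [← this d]
    apply Nat.div_eq_of_eq_mul_left (by norm_num)
    ring
  rw [hsum, ← Finset.prod_pow_eq_pow_sum, ← Finset.prod_mul_distrib]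
  refine Finset.prod_congr rfl fun j _ => ?_
  obtain ⟨m, rfl⟩ : ∃ m, n = m + 1 := ⟨n - 1, by omega⟩
  push_cast
  rw [mul_sub, mul_one, pow_mul]
  congr 1
  field_simp
  ring
end

section
/- Let p be a prime and q(t) ∈ ℚ_p[t] a nonzero polynomial of degree ≤ d₀. Then for every ε > 0, the Haar measure of {t ∈ ℤ_p : |q(t)|_p < ε} is at most d₀² p · (ε / ‖q‖)^{1/d₀}, where ‖q‖ = sup_{z∈ℤ_p} |q(z)|_p and the Haar measure is normalized so that ℤ_p has measure 1. -/
open MeasureTheory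

lemma pg_ball {p : ℕ} [Fact p.Prime]
    [MeasurableSpace ℚ_[p]] [BorelSpace ℚ_[p]]
    (μ : Measure ℚ_[p])
    (hinv : ∀ x : ℚ_[p], Measure.map (fun y => x + y) μ = μ)
    (r : ℝ) (a : ℚ_[p]) :
    μ (Metric.closedBall a r) = μ (Metric.closedBall 0 r) := by
  conv_lhs => rw [← hinv a]
  rw [Measure.map_apply (by fun_prop) Metric.isClosed_closedBall.measurableSet]
  congr 1
  ext y
  simp [dist_eq_norm]

lemma pg_nat_dist {p : ℕ} [Fact p.Prime] (m i j : ℕ) (hi : i < p ^ m) (hj : j < p ^ m)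
    (h : ‖((i : ℚ_[p]) - j)‖ ≤ (p : ℝ) ^ (-(m : ℤ))) : i = j := by
  have h2 : ‖(((i : ℤ) - (j : ℤ) : ℤ) : ℚ_[p])‖ ≤ (p : ℝ) ^ (-(m : ℤ)) := by
    push_cast; exact h
  rw [Padic.norm_int_le_pow_iff_dvd] at h2
  have h3 : (j : ℤ) ≡ i [ZMOD (p ^ m : ℕ)] := (Int.modEq_iff_dvd).2 (by exact_mod_cast h2)
  have h4 : j ≡ i [MOD (p ^ m)] := (Int.natCast_modEq_iff).1 h3
  exact (h4.eq_of_lt_of_lt hj hi).symm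

lemma pg_dist_sub {p : ℕ} [Fact p.Prime] {a b c : ℚ_[p]} {r : ℝ} (h : ‖a - b‖ ≤ r)
    (h' : ‖b - c‖ ≤ r) : ‖a - c‖ ≤ r := by
  have := IsUltrametricDist.norm_add_le_max (a - b) (b - c)
  rw [sub_add_sub_cancel] at this
  exact this.trans (max_le h h')

lemma pg_ball_measure {p : ℕ} [Fact p.Prime]
    [MeasurableSpace ℚ_[p]] [BorelSpace ℚ_[p]]
    (μ : Measure ℚ_[p])
    (hinv : ∀ x : ℚ_[p], Measure.map (fun y => x + y) μ = μ)
    (hnorm : μ {z : ℚ_[p] | ‖z‖ ≤ 1} = 1) (m : ℕ) (a : ℚ_[p]) :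
    μ (Metric.closedBall a ((p : ℝ) ^ (-(m : ℤ)))) ≤ ENNReal.ofReal ((p : ℝ) ^ (-(m : ℤ))) := by
  rw [pg_ball μ hinv]
  set B := μ (Metric.closedBall (0 : ℚ_[p]) ((p : ℝ) ^ (-(m : ℤ)))) with hB
  have hp1 : (1 : ℝ) ≤ p := by exact_mod_cast (Fact.out : p.Prime).one_le
  have hp0 : (0 : ℝ) < p := by linarith
  have hle1 : (p : ℝ) ^ (-(m : ℤ)) ≤ 1 := zpow_le_one_of_nonpos₀ hp1 (by simp)
  have key : μ (⋃ i ∈ Finset.range (p ^ m),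
      Metric.closedBall (i : ℚ_[p]) ((p : ℝ) ^ (-(m : ℤ)))) = (p ^ m : ℕ) * B := by
    rw [measure_biUnion_finset]
    · rw [Finset.sum_congr rfl fun (i : ℕ) _ => pg_ball μ hinv _ (i : ℚ_[p]), Finset.sum_const,
        Finset.card_range, nsmul_eq_mul]
    · intro i hi j hj hij
      refine Set.disjoint_left.2 fun x hx hx' => hij ?_
      simp only [Finset.coe_range, Set.mem_Iio] at hi hj
      rw [Metric.mem_closedBall, dist_eq_norm] at hx hx'
      rw [norm_sub_rev] at hx
      exact pg_nat_dist m i j hi hj (pg_dist_sub hx hx')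
    · intro i _
      exact Metric.isClosed_closedBall.measurableSet
  have h1 : ((p ^ m : ℕ) : ENNReal) * B ≤ 1 := by
    rw [← key, ← hnorm]
    refine measure_mono (Set.iUnion₂_subset fun i _ x hx => ?_)
    rw [Metric.mem_closedBall, dist_eq_norm] at hx
    have h2 : ‖(i : ℚ_[p]) - 0‖ ≤ 1 := by
      rw [sub_zero]; exact_mod_cast Padic.norm_int_le_one (p := p) (i : ℤ)
    have := pg_dist_sub (hx.trans hle1) h2
    simpa using this
  have hpm : (0 : ℝ) < (p : ℝ) ^ m := by positivity
  rw [zpow_neg, zpow_natCast, ENNReal.ofReal_inv_of_pos hpm, ENNReal.le_inv_iff_mul_le, mul_comm]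
  convert h1
  rw [← Nat.cast_pow, ENNReal.ofReal_natCast]

lemma pg_cover {p : ℕ} [Fact p.Prime] (m : ℕ) (t : ℚ_[p]) (ht : ‖t‖ ≤ 1) :
    ∃ i < p ^ m, ‖t - (i : ℚ_[p])‖ ≤ (p : ℝ) ^ (-(m : ℤ)) := by
  let x : ℤ_[p] := ⟨t, ht⟩
  refine ⟨x.appr m, x.appr_lt m, ?_⟩
  have := (PadicInt.norm_le_pow_iff_mem_span_pow _ m).2 (PadicInt.appr_spec m x)
  simpa [PadicInt.norm_def] using this

lemma pg_lagrange {p : ℕ} [Fact p.Prime] {d₀ k : ℕ} (q : Polynomial ℚ_[p])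
    (hdeg : q.natDegree ≤ d₀) (ε : ℝ) (hε : 0 < ε) (s : Finset ℕ) (hs : s.card = d₀ + 1)
    (x : ℕ → ℚ_[p]) (hx1 : ∀ i ∈ s, ‖x i‖ ≤ 1) (hxe : ∀ i ∈ s, ‖q.eval (x i)‖ ≤ ε)
    (hsep : ∀ i ∈ s, ∀ j ∈ s, i ≠ j → (p : ℝ) ^ (-(k : ℤ)) ≤ ‖x i - x j‖)
    (z : ℚ_[p]) (hz : ‖z‖ ≤ 1) : ‖q.eval z‖ ≤ ε * (p : ℝ) ^ (d₀ * k) := by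
  have hp0 : (0 : ℝ) < p := by exact_mod_cast (Fact.out : p.Prime).pos
  have hinj : Set.InjOn x s := by
    intro i hi j hj hij
    by_contra hne
    have := hsep i hi j hj hne
    rw [hij, sub_self, norm_zero] at this
    exact absurd this (not_le.2 (by positivity))
  have hd : q.degree < s.card := by
    rw [hs]
    refine lt_of_le_of_lt Polynomial.degree_le_natDegree ?_
    exact_mod_cast Nat.lt_succ_of_le hdeg
  rw [Lagrange.eq_interpolate hinj hd, Lagrange.interpolate_apply, Polynomial.eval_finsetSum]
  refine IsUltrametricDist.norm_sum_le_of_forall_le_of_nonneg (by positivity) fun i hi => ?_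
  rw [Polynomial.eval_mul, Polynomial.eval_C, norm_mul]
  refine mul_le_mul (hxe i hi) ?_ (norm_nonneg _) hε.le
  rw [Lagrange.basis, Polynomial.eval_prod, norm_prod]
  have hc : (s.erase i).card = d₀ := by rw [Finset.card_erase_of_mem hi, hs]; rfl
  calc ∏ j ∈ s.erase i, ‖Polynomial.eval z (Lagrange.basisDivisor (x i) (x j))‖
      ≤ ∏ j ∈ s.erase i, (p : ℝ) ^ k := by
        refine Finset.prod_le_prod (fun _ _ => norm_nonneg _) fun j hj => ?_
        rw [Finset.mem_erase] at hj
        have h1 := hsep i hi j hj.2 hj.1.symm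
        have h2 : ‖z - x j‖ ≤ 1 :=
          pg_dist_sub (b := 0) (by simpa using hz) (by simpa using hx1 j hj.2)
        simp only [Lagrange.basisDivisor, Polynomial.eval_mul, Polynomial.eval_C,
          Polynomial.eval_sub, Polynomial.eval_X, norm_mul, norm_inv]
        have h3 : ‖x i - x j‖⁻¹ ≤ (p : ℝ) ^ k := by
          rw [zpow_neg, zpow_natCast] at h1
          exact inv_le_of_inv_le₀ (by positivity) h1
        calc ‖x i - x j‖⁻¹ * ‖z - x j‖ ≤ (p : ℝ) ^ k * 1 :=
              mul_le_mul h3 h2 (norm_nonneg _) (by positivity)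
          _ = _ := mul_one _
    _ = (p : ℝ) ^ (d₀ * k) := by rw [Finset.prod_const, hc, ← pow_mul, mul_comm]

/-- Let `q ∈ ℚ_p[t]` be a nonzero polynomial of degree `≤ d₀` and let `μ` be the Haar measure
on `ℚ_p` normalized so that `μ(ℤ_p) = 1`. Then for every `ε > 0`,
`μ {t ∈ ℤ_p : |q(t)|_p < ε} ≤ d₀² p (ε/‖q‖)^{1/d₀}` where `‖q‖ = sup_{z ∈ ℤ_p} |q(z)|_p`. -/
theorem padic_polynomial_good {p : ℕ} [Fact p.Prime]
    [MeasurableSpace ℚ_[p]] [BorelSpace ℚ_[p]]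
    (μ : Measure ℚ_[p])
    (hinv : ∀ x : ℚ_[p], Measure.map (fun y => x + y) μ = μ)
    (hnorm : μ {z : ℚ_[p] | ‖z‖ ≤ 1} = 1)
    {d₀ : ℕ} (hd₀ : 1 ≤ d₀) (q : Polynomial ℚ_[p]) (hq : q ≠ 0) (hdeg : q.natDegree ≤ d₀)
    (ε : ℝ) (hε : 0 < ε) :
    μ {t : ℚ_[p] | ‖t‖ ≤ 1 ∧ ‖q.eval t‖ < ε} ≤
      ENNReal.ofReal ((d₀ : ℝ) ^ 2 * p *
        (ε / ⨆ z : {z : ℚ_[p] // ‖z‖ ≤ 1}, ‖q.eval (z : ℚ_[p])‖) ^ ((d₀ : ℝ)⁻¹)) := by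
  classical
  set N : ℝ := ⨆ z : {z : ℚ_[p] // ‖z‖ ≤ 1}, ‖q.eval (z : ℚ_[p])‖ with hN
  have hp1 : (1 : ℝ) < p := by exact_mod_cast (Fact.out : p.Prime).one_lt
  have hp0 : (0 : ℝ) < p := by linarith
  have hd1 : (1 : ℝ) ≤ d₀ := by exact_mod_cast hd₀
  have hbdd : BddAbove (Set.range fun z : {z : ℚ_[p] // ‖z‖ ≤ 1} => ‖q.eval (z : ℚ_[p])‖) := by
    refine ⟨∑ i ∈ Finset.range (q.natDegree + 1), ‖q.coeff i‖, ?_⟩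
    rintro _ ⟨⟨z, hz⟩, rfl⟩
    simp only [Polynomial.eval_eq_sum_range]
    refine (norm_sum_le _ _).trans (Finset.sum_le_sum fun i _ => ?_)
    rw [norm_mul, norm_pow]
    exact mul_le_of_le_one_right (norm_nonneg _) (pow_le_one₀ (norm_nonneg _) hz)
  have hNpos : 0 < N := by
    by_contra hcon
    refine hq (Polynomial.eq_zero_of_infinite_isRoot q ?_)
    refine (Set.infinite_range_of_injective (Nat.cast_injective (R := ℚ_[p]))).mono ?_
    rintro _ ⟨n, rfl⟩
    have h2 : ‖(n : ℚ_[p])‖ ≤ 1 := by exact_mod_cast Padic.norm_int_le_one (p := p) (n : ℤ)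
    have h3 := le_ciSup hbdd ⟨(n : ℚ_[p]), h2⟩
    exact norm_le_zero_iff.1 (h3.trans (not_lt.1 hcon))
  have hdd : (d₀ : ℝ) ≤ (d₀ : ℝ) ^ 2 * p := by nlinarith [sq_nonneg (d₀ : ℝ)]
  rcases le_or_gt N ε with hle | hlt
  · have h1 : (1 : ℝ) ≤ (ε / N) ^ ((d₀ : ℝ)⁻¹) :=
      Real.one_le_rpow ((one_le_div hNpos).2 hle) (by positivity)
    calc μ {t : ℚ_[p] | ‖t‖ ≤ 1 ∧ ‖q.eval t‖ < ε} ≤ μ {z : ℚ_[p] | ‖z‖ ≤ 1} :=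
          measure_mono fun t ht => ht.1
      _ = ENNReal.ofReal 1 := by rw [hnorm, ENNReal.ofReal_one]
      _ ≤ _ := ENNReal.ofReal_le_ofReal (by nlinarith)
  have hex : ∃ n : ℕ, N ≤ ε * (p : ℝ) ^ (d₀ * n) := by
    obtain ⟨n, hn⟩ := pow_unbounded_of_one_lt (N / ε) hp1
    refine ⟨n, ?_⟩
    rw [div_lt_iff₀ hε] at hn
    have : (p : ℝ) ^ n ≤ (p : ℝ) ^ (d₀ * n) :=
      pow_le_pow_right₀ hp1.le (Nat.le_mul_of_pos_left n hd₀)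
    nlinarith
  obtain ⟨k, hk, hk'⟩ : ∃ k : ℕ, ε * (p : ℝ) ^ (d₀ * k) < N ∧
      N ≤ ε * (p : ℝ) ^ (d₀ * (k + 1)) := by
    have h0 : Nat.find hex ≠ 0 := by
      intro h
      have := Nat.find_spec hex
      rw [h] at this
      simp at this
      linarith
    obtain ⟨k, hk⟩ := Nat.exists_eq_succ_of_ne_zero h0
    refine ⟨k, not_le.1 (Nat.find_min hex (by omega)), ?_⟩
    have := Nat.find_spec hex
    rwa [hk] at this
  set r : ℝ := (p : ℝ) ^ (-((k + 1 : ℕ) : ℤ)) with hr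
  set S : Set ℚ_[p] := {t : ℚ_[p] | ‖t‖ ≤ 1 ∧ ‖q.eval t‖ < ε} with hS
  let I : Finset ℕ := (Finset.range (p ^ (k + 1))).filter fun i => ∃ x ∈ S, ‖x - (i : ℚ_[p])‖ ≤ r
  have hI : ∀ i : ℕ, ∃ x : ℚ_[p], i ∈ I → x ∈ S ∧ ‖x - (i : ℚ_[p])‖ ≤ r := by
    intro i
    by_cases h : i ∈ I
    · obtain ⟨x, hx⟩ := (Finset.mem_filter.1 h).2
      exact ⟨x, fun _ => hx⟩
    · exact ⟨0, fun h' => absurd h' h⟩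
  choose x hx using hI
  have hcard : I.card ≤ d₀ := by
    by_contra hcon
    obtain ⟨s, hsI, hs⟩ := Finset.exists_subset_card_eq (Nat.succ_le_of_lt (not_le.1 hcon))
    refine absurd hk (not_lt.2 ?_)
    haveI : Nonempty {z : ℚ_[p] // ‖z‖ ≤ 1} := ⟨⟨0, by simp⟩⟩
    refine ciSup_le fun z => pg_lagrange q hdeg ε hε s hs x (fun i hi => (hx i (hsI hi)).1.1)
      (fun i hi => (hx i (hsI hi)).1.2.le) ?_ z z.2
    intro i hi j hj hij
    by_contra hlt'
    refine hij (pg_nat_dist (p := p) (k + 1) i j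
      (Finset.mem_range.1 (Finset.mem_filter.1 (hsI hi)).1)
      (Finset.mem_range.1 (Finset.mem_filter.1 (hsI hj)).1) ?_)
    have h1 : ‖x i - x j‖ ≤ r := by
      rw [hr, Padic.norm_le_pow_iff_norm_lt_pow_add_one]
      have : (-((k + 1 : ℕ) : ℤ) + 1) = -(k : ℤ) := by push_cast; ring
      rw [this]
      exact not_le.1 hlt'
    have h2 := (hx i (hsI hi)).2
    rw [norm_sub_rev] at h2
    exact pg_dist_sub (pg_dist_sub h2 h1) (hx j (hsI hj)).2
  have hsub : S ⊆ ⋃ i ∈ I, Metric.closedBall (i : ℚ_[p]) r := by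
    intro t ht
    obtain ⟨i, hi, hti⟩ := pg_cover (k + 1) t ht.1
    refine Set.mem_iUnion₂.2 ⟨i, Finset.mem_filter.2 ⟨Finset.mem_range.2 hi, t, ht, hti⟩, ?_⟩
    rwa [Metric.mem_closedBall, dist_eq_norm]
  have hr0 : 0 < r := by positivity
  have hrle : r ≤ (ε / N) ^ ((d₀ : ℝ)⁻¹) := by
    have h1 : r ^ d₀ ≤ ε / N := by
      rw [hr, zpow_neg, zpow_natCast, inv_pow, ← pow_mul, mul_comm (k + 1) d₀, le_div_iff₀ hNpos,
        inv_mul_le_iff₀ (by positivity), mul_comm]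
      exact hk'
    calc r = (r ^ d₀) ^ ((d₀ : ℝ)⁻¹) := (Real.pow_rpow_inv_natCast hr0.le (by omega)).symm
      _ ≤ _ := Real.rpow_le_rpow (by positivity) h1 (by positivity)
  calc μ S ≤ μ (⋃ i ∈ I, Metric.closedBall (i : ℚ_[p]) r) := measure_mono hsub
    _ ≤ ∑ i ∈ I, μ (Metric.closedBall (i : ℚ_[p]) r) := measure_biUnion_finset_le _ _
    _ ≤ ∑ i ∈ I, ENNReal.ofReal r :=
        Finset.sum_le_sum fun i _ => pg_ball_measure μ hinv hnorm (k + 1) i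
    _ = ENNReal.ofReal (I.card * r) := by
        rw [Finset.sum_const, nsmul_eq_mul, ENNReal.ofReal_mul (by positivity),
          ENNReal.ofReal_natCast]
    _ ≤ _ := by
        refine ENNReal.ofReal_le_ofReal ?_
        have : (I.card : ℝ) ≤ d₀ := by exact_mod_cast hcard
        exact mul_le_mul (this.trans hdd) hrle hr0.le (by positivity)
end

section
/- Let Δ be a lattice (i.e. a discrete cocompact ℤ_S-submodule of full rank) in ℚ_S^d, where S = {∞} ∪ S_f is a finite set of places of ℚ. Then the set of nonzero ℤ_S-submodules of Δ whose covolume is strictly less than 1 is finite. -/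
open scoped BigOperators

variable {s : ℕ} (P : Fin s → ℕ) [∀ i, Fact (P i).Prime]

/-- The ring `ℚ_S = ℝ × ∏_{p ∈ S_f} ℚ_p`, for the finite set of places
`S = {∞} ∪ {P 0, …, P (s−1)}`. -/
abbrev QSring := ℝ × Π i : Fin s, ℚ_[P i]

/-- The diagonal embedding `ℚ → ℚ_S`. -/
noncomputable def diagQ : ℚ →+* QSring P :=
  (Rat.castHom ℝ).prod (Pi.ringHom fun i => Rat.castHom ℚ_[P i])

/-- The ring of `S`-integers `ℤ_S = ℤ[1/p_S]` (where `p_S = ∏_{p ∈ S_f} p`), embedded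
diagonally in `ℚ_S`: it is the image under the diagonal embedding of the smallest subring of
`ℚ` containing `1/p_S`. -/
noncomputable def ZSring : Subring (QSring P) :=
  (Subring.closure {(((∏ i, P i : ℕ) : ℚ))⁻¹}).map (diagQ P)

/-- The covolume of the discrete `ℤ_S`-submodule of `ℚ_S^d` spanned by a `ℤ_S`-basis
`v₁, …, v_k`, computed via the wedge-product formula
`cov = ‖(v₁∧⋯∧v_k)_∞‖_euc · ∏_{p ∈ S_f} ‖(v₁∧⋯∧v_k)_p‖_p` :
the archimedean factor is the square root of the Gram determinant, and the factor at a finite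
place `p` is the maximum of the `p`-adic absolute values of the `k × k` minors. -/
noncomputable def covolOfBasis {d k : ℕ} (v : Fin k → (Fin d → QSring P)) : ℝ :=
  Real.sqrt (Matrix.det (Matrix.of fun i j : Fin k => ∑ a : Fin d, (v i a).1 * (v j a).1)) *
    ∏ t : Fin s,
      ((Finset.univ.sup fun e : Fin k ↪ Fin d =>
        ‖Matrix.det (Matrix.of fun r c : Fin k => (v r (e c)).2 t)‖₊ : NNReal) : ℝ)

/-- Cauchy-Binet in function form. -/
theorem aux_det_mul {R : Type*} [CommRing R] {k d : ℕ} (A : Matrix (Fin k) (Fin d) R)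
    (B : Matrix (Fin d) (Fin k) R) :
    (A * B).det = ∑ f : Fin k → Fin d, (∏ i, B (f i) i) * (A.submatrix id f).det := by
  have h : ∀ M : Matrix (Fin k) (Fin k) R, M.det = Matrix.detRowAlternating (Matrix.transpose M) := by
    intro M; exact (Matrix.det_transpose M).symm
  rw [h]
  have h2 : Matrix.transpose (A * B) = fun i => ∑ j : Fin d, (B j i) • (fun r => A r j) := by
    ext i r
    simp [Matrix.mul_apply, mul_comm]
  rw [h2]
  have := (Matrix.detRowAlternating (R := R) (n := Fin k)).toMultilinearMap.map_sum
    (fun i (j : Fin d) => (B j i) • (fun r => A r j))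
  refine this.trans ?_
  refine Finset.sum_congr rfl fun f _ => ?_
  have := (Matrix.detRowAlternating (R := R) (n := Fin k)).toMultilinearMap.map_smul_univ
    (fun i => B (f i) i) (fun i r => A r (f i))
  refine this.trans ?_
  rw [h]
  rfl

theorem aux_gram {k d : ℕ} (A : Matrix (Fin k) (Fin d) ℝ) :
    (k.factorial : ℝ) * (A * A.transpose).det
      = ∑ f : Fin k → Fin d, (A.submatrix id f).det ^ 2 := by
  have h : ∀ σ : Equiv.Perm (Fin k), (A * A.transpose).det =
      ∑ f : Fin k → Fin d, (((Equiv.Perm.sign σ : ℤ) : ℝ) * ∏ i, A i (f (σ i))) *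
        (A.submatrix id f).det := by
    intro σ
    rw [aux_det_mul]
    rw [← (Equiv.arrowCongr σ.symm (Equiv.refl (Fin d))).sum_comp]
    refine Finset.sum_congr rfl fun f _ => ?_
    have : A.submatrix id ((Equiv.arrowCongr σ.symm (Equiv.refl (Fin d))) f)
        = (A.submatrix id f).submatrix id σ := by
      ext; simp
    rw [this, Matrix.det_permute']
    simp only [Equiv.arrowCongr_apply, Equiv.coe_refl, Function.comp, id, Matrix.transpose_apply,
      Equiv.symm_symm]
    ring
  have h2 : ∑ σ : Equiv.Perm (Fin k), (A * A.transpose).det = (k.factorial : ℝ) * (A * A.transpose).det := by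
    simp [Fintype.card_perm]
  rw [← h2, Finset.sum_congr rfl (fun σ _ => h σ), Finset.sum_comm]
  refine Finset.sum_congr rfl fun f _ => ?_
  rw [← Finset.sum_mul, sq]
  congr 1
  rw [← Matrix.det_transpose, Matrix.det_apply']
  rfl

theorem aux_cramer {k d : ℕ} (u : Matrix (Fin k) (Fin d) ℚ) (e : Fin k → Fin d) (r : Fin k)
    (j : Fin d) : (u.submatrix id e).det * u r j =
      ∑ i, u r (e i) * (u.submatrix id (Function.update e i j)).det := by
  have := congrFun (Matrix.mulVec_cramer (u.submatrix id e) (fun r => u r j)) r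
  simp only [Pi.smul_apply, smul_eq_mul] at this
  rw [← this, Matrix.mulVec, dotProduct]
  refine Finset.sum_congr rfl fun i _ => ?_
  rw [Matrix.cramer_apply]
  simp only [Matrix.submatrix_apply, id]
  congr 2
  ext a b
  by_cases h : b = i
  · subst h; simp
  · simp [h]

theorem aux_exists_minor {k d : ℕ} (u : Matrix (Fin k) (Fin d) ℚ)
    (hu : ∀ c : Fin k → ℚ, Matrix.vecMul c u = 0 → c = 0) :
    ∃ e : Fin k → Fin d, (u.submatrix id e).det ≠ 0 := by
  obtain ⟨g, hg⟩ := LinearMap.exists_leftInverse_of_injective (Matrix.vecMulLinear u)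
    (LinearMap.ker_eq_bot'.2 fun c hc => hu c hc)
  by_contra! hcon
  have h1 : u * (LinearMap.toMatrix' g).transpose = 1 := by
    have : LinearMap.toMatrix' (g ∘ₗ Matrix.vecMulLinear u) = 1 := by rw [hg]; simp
    rw [LinearMap.toMatrix'_comp] at this
    have h3 : LinearMap.toMatrix' (Matrix.vecMulLinear u) = u.transpose := by
      ext i j
      simp [LinearMap.toMatrix'_apply]
    rw [h3] at this
    rw [← Matrix.transpose_transpose u, ← Matrix.transpose_mul, this, Matrix.transpose_one]
  have h2 := aux_det_mul u (LinearMap.toMatrix' g).transpose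
  rw [h1] at h2
  simp [hcon] at h2

/-- The ring of `S`-integers inside `ℚ`. -/
abbrev ZQ : Subring ℚ := Subring.closure {(((∏ i, P i : ℕ) : ℚ))⁻¹}

theorem aux_prod_ne : (((∏ i, P i : ℕ) : ℚ)) ≠ 0 := by
  rw [Nat.cast_ne_zero, Finset.prod_ne_zero_iff]
  intro i _
  exact (Fact.out : (P i).Prime).ne_zero

theorem aux_den (q : ℚ) (hq : q ∈ ZQ P) :
    ∃ (n : ℕ) (z : ℤ), (((∏ i, P i : ℕ) : ℚ)) ^ n * q = z := by
  have hm := aux_prod_ne P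
  set m : ℚ := ((∏ i, P i : ℕ) : ℚ) with hmdef
  have hmi : m = ((∏ i, P i : ℕ) : ℤ) := by simp [hmdef]
  induction hq using Subring.closure_induction with
  | mem x hx =>
    rw [Set.mem_singleton_iff] at hx
    exact ⟨1, 1, by rw [hx]; simp [← hmdef, hm]⟩
  | zero => exact ⟨0, 0, by simp⟩
  | one => exact ⟨0, 1, by simp⟩
  | add x y _ _ hx hy =>
    obtain ⟨n, z, h⟩ := hx
    obtain ⟨n', z', h'⟩ := hy
    refine ⟨n + n', ((∏ i, P i : ℕ) : ℤ) ^ n' * z + ((∏ i, P i : ℕ) : ℤ) ^ n * z', ?_⟩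
    rw [Int.cast_add, Int.cast_mul, Int.cast_mul, Int.cast_pow, Int.cast_pow, ← hmi, ← h, ← h']
    ring
  | neg x _ hx =>
    obtain ⟨n, z, h⟩ := hx
    exact ⟨n, -z, by rw [Int.cast_neg, ← h]; ring⟩
  | mul x y _ _ hx hy =>
    obtain ⟨n, z, h⟩ := hx
    obtain ⟨n', z', h'⟩ := hy
    exact ⟨n + n', z * z', by rw [Int.cast_mul, ← h, ← h']; ring⟩

theorem aux_inv_mem : (((∏ i, P i : ℕ) : ℚ))⁻¹ ∈ ZQ P :=
  Subring.subset_closure rfl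

theorem aux_zpow_mem (t : Fin s) (n : ℤ) : ((P t : ℕ) : ℚ) ^ n ∈ ZQ P := by
  have hp : ((P t : ℕ) : ℚ) ≠ 0 := Nat.cast_ne_zero.2 (Fact.out : (P t).Prime).ne_zero
  have h1 : ((P t : ℕ) : ℚ)⁻¹ ∈ ZQ P := by
    obtain ⟨c, hc⟩ := Finset.dvd_prod_of_mem P (Finset.mem_univ t)
    have hm := aux_prod_ne P
    have : ((P t : ℕ) : ℚ)⁻¹ = (c : ℚ) * (((∏ i, P i : ℕ) : ℚ))⁻¹ := by
      rw [hc] at hm ⊢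
      push_cast at hm ⊢
      have : (c : ℚ) ≠ 0 := right_ne_zero_of_mul hm
      field_simp
    rw [this]
    exact mul_mem (natCast_mem _ _) (aux_inv_mem P)
  rcases n with n | n
  · simp only [Int.ofNat_eq_natCast, zpow_natCast]
    exact pow_mem (natCast_mem _ _) _
  · rw [zpow_negSucc, ← inv_pow]
    exact pow_mem h1 _

theorem aux_int (r : ℚ) (hr : r ∈ ZQ P) (h : ∀ t, ‖(r : ℚ_[P t])‖ ≤ 1) : ∃ z : ℤ, r = z := by
  obtain ⟨n, z, hz⟩ := aux_den P r hr
  refine ⟨r.num, ?_⟩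
  have hden : r.den = 1 := by
    by_contra hne
    obtain ⟨p, hp, hpd⟩ := Nat.exists_prime_and_dvd hne
    have h1 : (r.den : ℤ) ∣ ((∏ i, P i : ℕ) : ℤ) ^ n := by
      have h2 : ((∏ i, P i : ℕ) : ℤ) ^ n * r.num = z * r.den := by
        have : (((∏ i, P i : ℕ) : ℚ)) ^ n * r.num = z * r.den := by
          rw [← hz, mul_assoc, Rat.mul_den_eq_num]
        exact_mod_cast this
      have h3 : (r.den : ℤ) ∣ ((∏ i, P i : ℕ) : ℤ) ^ n * r.num := ⟨z, by rw [h2]; ring⟩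
      refine IsCoprime.dvd_of_dvd_mul_right ?_ h3
      rw [Int.isCoprime_iff_gcd_eq_one]
      have := r.reduced
      rw [Int.gcd_comm]
      simpa [Int.gcd, Nat.Coprime] using this
    have h2 : r.den ∣ (∏ i, P i) ^ n := by exact_mod_cast h1
    have h3 := hp.dvd_of_dvd_pow (hpd.trans h2)
    obtain ⟨t, _, ht⟩ := (hp.prime.dvd_finset_prod_iff _).1 h3
    have h4 : p = P t := (Nat.prime_dvd_prime_iff_eq hp (Fact.out : (P t).Prime)).1 ht
    subst h4
    have h5 := h t
    rw [Padic.norm_rat_le_one_iff_padicValuation_le_one, Rat.padicValuation_le_one_iff] at h5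
    exact h5 hpd
  conv_lhs => rw [← Rat.num_div_den r, hden]
  simp

theorem aux_height (hP : Function.Injective P) {ι : Type*} [Finite ι] (w : ι → ℚ) (hw : ∀ f, w f ∈ ZQ P)
    (f₀ : ι) (hf₀ : w f₀ ≠ 0) (A : ℝ) (a : Fin s → ℝ) (C : ℝ) (hA : ∀ f, |(w f : ℝ)| ≤ A)
    (ha : ∀ t f, ‖(w f : ℚ_[P t])‖ ≤ a t) (hC : A * ∏ t, a t ≤ C) :
    ∃ q ∈ ZQ P, q ≠ 0 ∧ ∃ z : ι → ℤ, (∀ f, q * w f = z f) ∧ ∀ f, |((z f : ℤ) : ℝ)| ≤ C := by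
  have hA0 : 0 ≤ A := (abs_nonneg _).trans (hA f₀)
  have h1 : ∀ t, ∃ n : ℤ, ((P t : ℕ) : ℝ) ^ n ≤ a t ∧ ∀ f, ‖(w f : ℚ_[P t])‖ ≤ ((P t : ℕ) : ℝ) ^ n := by
    intro t
    haveI : Nonempty ι := ⟨f₀⟩
    obtain ⟨f₁, hf₁⟩ := Finite.exists_max (fun f => ‖(w f : ℚ_[P t])‖)
    have hne : (w f₁ : ℚ_[P t]) ≠ 0 := by
      intro h0
      have := hf₁ f₀
      rw [h0, norm_zero] at this
      have := norm_le_zero_iff.1 this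
      exact hf₀ (by exact_mod_cast this)
    refine ⟨-(w f₁ : ℚ_[P t]).valuation, ?_, ?_⟩
    · rw [← Padic.norm_eq_zpow_neg_valuation hne]; exact ha t f₁
    · rw [← Padic.norm_eq_zpow_neg_valuation hne]; exact hf₁
  choose n hn1 hn2 using h1
  have hp0 : ∀ t, (0 : ℝ) < (P t : ℕ) := fun t => Nat.cast_pos.2 (Fact.out : (P t).Prime).pos
  have hp0' : ∀ t, ((P t : ℕ) : ℚ) ≠ 0 := fun t => Nat.cast_ne_zero.2 (Fact.out : (P t).Prime).ne_zero
  have hqmem : ∏ t, ((P t : ℕ) : ℚ) ^ n t ∈ ZQ P := prod_mem fun t _ => aux_zpow_mem P t _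
  have hqnorm : ∀ t, ‖((∏ t, ((P t : ℕ) : ℚ) ^ n t : ℚ) : ℚ_[P t])‖ = (((P t : ℕ) : ℝ) ^ n t)⁻¹ := by
    intro t
    push_cast
    rw [norm_prod, Finset.prod_eq_single t]
    · rw [norm_zpow, Padic.norm_p, inv_zpow]
    · intro b _ hb
      rw [norm_zpow]
      have : ‖((P b : ℕ) : ℚ_[P t])‖ = 1 := by
        rw [Padic.norm_natCast_eq_one_iff]
        exact (Nat.coprime_primes (Fact.out) (Fact.out)).2 fun h => hb (hP h.symm)
      rw [this, one_zpow]
    · simp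
  have hz : ∀ f, ∃ z : ℤ, (∏ t, ((P t : ℕ) : ℚ) ^ n t) * w f = z := by
    intro f
    refine aux_int P _ (mul_mem hqmem (hw f)) fun t => ?_
    rw [Rat.cast_mul, norm_mul, hqnorm, inv_mul_le_iff₀ (zpow_pos (hp0 t) _), mul_one]
    exact hn2 t f
  choose z hz using hz
  refine ⟨_, hqmem, Finset.prod_ne_zero_iff.2 fun t _ => zpow_ne_zero _ (hp0' t), z, hz, fun f => ?_⟩
  have e : ((z f : ℤ) : ℝ) = ((∏ t, ((P t : ℕ) : ℝ) ^ n t)) * (w f : ℝ) := by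
    have := congrArg (fun x : ℚ => (x : ℝ)) (hz f)
    rw [Rat.cast_mul] at this
    push_cast at this
    exact this.symm
  rw [e, abs_mul, abs_of_nonneg (Finset.prod_nonneg fun t _ => (zpow_pos (hp0 t) _).le)]
  refine le_trans ?_ hC
  rw [mul_comm]
  refine mul_le_mul (hA f) (Finset.prod_le_prod (fun t _ => (zpow_pos (hp0 t) _).le) fun t _ => hn1 t)
    (Finset.prod_nonneg fun t _ => (zpow_pos (hp0 t) _).le) hA0

theorem aux_smul_mem {d : ℕ} (Δ : Submodule ↥(ZSring P) (Fin d → QSring P)) (q : ℚ) (hq : q ∈ ZQ P)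
    (x : Fin d → QSring P) (hx : x ∈ Δ) : diagQ P q • x ∈ Δ :=
  Δ.smul_mem (⟨diagQ P q, ⟨q, hq, rfl⟩⟩ : ZSring P) hx

theorem aux_finite {d : ℕ} (Δ : Submodule ↥(ZSring P) (Fin d → QSring P))
    (hdisc : DiscreteTopology Δ) (R : ℝ) :
    {x : Fin d → QSring P | x ∈ Δ ∧ ‖x‖ ≤ R}.Finite := by
  have hd : DiscreteTopology Δ.toAddSubgroup := hdisc
  have hc : IsClosed (Δ.toAddSubgroup : Set (Fin d → QSring P)) := AddSubgroup.isClosed_of_discrete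
  have := Metric.finite_isBounded_inter_isClosed (s := (Δ.toAddSubgroup : Set (Fin d → QSring P)))
    (isDiscrete_iff_discreteTopology.mpr hd) (Metric.isBounded_closedBall (x := (0 : Fin d → QSring P)) (r := R)) hc
  refine this.subset ?_
  rintro x ⟨h1, h2⟩
  exact ⟨by simpa using h2, h1⟩

theorem aux_norm_le {d : ℕ} (x : Fin d → QSring P) (R : ℝ) (hR : 1 ≤ R)
    (h1 : ∀ a, ‖(x a).1‖ ≤ R) (h2 : ∀ a t, ‖(x a).2 t‖ ≤ 1) : ‖x‖ ≤ R := by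
  have hR0 : 0 ≤ R := by linarith
  rw [pi_norm_le_iff_of_nonneg hR0]
  intro a
  rw [Prod.norm_def, max_le_iff]
  refine ⟨h1 a, ?_⟩
  rw [pi_norm_le_iff_of_nonneg hR0]
  exact fun t => (h2 a t).trans hR

theorem aux_ker {d : ℕ} (Δ : Submodule ↥(ZSring P) (Fin d → QSring P))
    (hdisc : DiscreteTopology Δ) (x : Fin d → QSring P) (hx : x ∈ Δ) (h1 : ∀ a, (x a).1 = 0)
    (h2 : ∀ a t, ‖(x a).2 t‖ ≤ 1) : x = 0 := by
  have hf := aux_finite P Δ hdisc 1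
  have hmaps : ∀ n : ℕ, n • x ∈ {x : Fin d → QSring P | x ∈ Δ ∧ ‖x‖ ≤ 1} := by
    intro n
    refine ⟨Δ.nsmul_mem hx n, aux_norm_le P _ 1 le_rfl (fun a => by simp [h1]) fun a t => ?_⟩
    change ‖n • (x a).2 t‖ ≤ 1
    rw [nsmul_eq_mul, norm_mul]
    have : ‖((n : ℕ) : ℚ_[P t])‖ ≤ 1 := by simpa using Padic.norm_int_le_one (p := P t) n
    exact mul_le_one₀ this (norm_nonneg _) (h2 a t)
  have : ¬ Function.Injective (fun n : ℕ => n • x) := by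
    intro hinj
    exact Set.infinite_range_of_injective hinj (hf.subset (by rintro _ ⟨n, rfl⟩; exact hmaps n))
  simp only [Function.Injective, not_forall] at this
  obtain ⟨m, n, hmn, hne⟩ := this
  ext a
  · exact h1 a
  · rename_i t
    have h3 : m • (x a).2 t = n • (x a).2 t := congrArg (fun y : Fin d → QSring P => (y a).2 t) hmn
    rw [nsmul_eq_mul, nsmul_eq_mul] at h3
    by_contra h4
    exact hne (by exact_mod_cast mul_right_cancel₀ h4 h3)

theorem aux_scale {d : ℕ} (x : Fin d → QSring P) :
    ∃ n : ℕ, ∀ a t, ‖((diagQ P ((((∏ i, P i : ℕ) : ℚ)) ^ n) • x) a).2 t‖ ≤ 1 := by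
  have key : ∀ t, ‖((∏ i, P i : ℕ) : ℚ_[P t])‖ ≤ (P t : ℝ)⁻¹ := by
    intro t
    have := (Padic.norm_int_le_pow_iff_dvd (p := P t) ((∏ i, P i : ℕ) : ℤ) 1).2
      (by
        have := Finset.dvd_prod_of_mem P (Finset.mem_univ t)
        rw [pow_one]; exact_mod_cast this)
    simpa using this
  have h : ∀ y : Fin d × Fin s, ∃ N : ℕ, ∀ n ≥ N, ‖((∏ i, P i : ℕ) : ℚ_[P y.2])‖ ^ n * ‖(x y.1).2 y.2‖ ≤ 1 := by
    rintro ⟨a, t⟩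
    have hp : (1 : ℝ) < P t := Nat.one_lt_cast.2 (Fact.out : (P t).Prime).one_lt
    have ht : Filter.Tendsto (fun n : ℕ => ‖((∏ i, P i : ℕ) : ℚ_[P t])‖ ^ n * ‖(x a).2 t‖)
        Filter.atTop (nhds (0 * ‖(x a).2 t‖)) :=
      (tendsto_pow_atTop_nhds_zero_of_lt_one (norm_nonneg _)
        ((key t).trans_lt (inv_lt_one_of_one_lt₀ hp))).mul_const _
    rw [zero_mul] at ht
    exact Filter.eventually_atTop.1 (ht.eventually_le_const zero_lt_one)
  choose N hN using h
  refine ⟨Finset.univ.sup N, fun a t => ?_⟩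
  have := hN (a, t) (Finset.univ.sup N) (Finset.le_sup (Finset.mem_univ _))
  simp only [Pi.smul_apply, smul_eq_mul, Prod.snd_mul, Pi.mul_apply, norm_mul]
  refine le_trans (le_of_eq ?_) this
  congr 1
  rw [← norm_pow]
  simp [diagQ]

/-- The integral part of a lattice, projected to the real place. -/
def auxL {d : ℕ} (Δ : Submodule ↥(ZSring P) (Fin d → QSring P)) : Submodule ℤ (Fin d → ℝ) :=
  AddSubgroup.toIntSubmodule
  { carrier := {y | ∃ x ∈ Δ, (∀ a t, ‖(x a).2 t‖ ≤ 1) ∧ ∀ a, y a = (x a).1}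
    zero_mem' := ⟨0, Δ.zero_mem, by simp, by simp⟩
    add_mem' := by
      rintro y y' ⟨x, hx, h1, h2⟩ ⟨x', hx', h1', h2'⟩
      refine ⟨x + x', Δ.add_mem hx hx', fun a t => ?_, fun a => by simp [h2, h2']⟩
      exact (Padic.nonarchimedean _ _).trans (max_le (h1 a t) (h1' a t))
    neg_mem' := by
      rintro y ⟨x, hx, h1, h2⟩
      exact ⟨-x, Δ.neg_mem hx, fun a t => by simpa using h1 a t, fun a => by simp [h2]⟩ }

theorem mem_auxL {d : ℕ} (Δ : Submodule ↥(ZSring P) (Fin d → QSring P)) (y : Fin d → ℝ) :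
    y ∈ auxL P Δ ↔ ∃ x ∈ Δ, (∀ a t, ‖(x a).2 t‖ ≤ 1) ∧ ∀ a, y a = (x a).1 := Iff.rfl

theorem auxL_discrete {d : ℕ} (Δ : Submodule ↥(ZSring P) (Fin d → QSring P))
    (hdisc : DiscreteTopology Δ) : DiscreteTopology (auxL P Δ) := by
  refine discreteTopology_of_isOpen_singleton_zero ?_
  refine isOpen_singleton_of_finite_mem_nhds 0 (s := Metric.closedBall 0 1) ?_ ?_
  · exact Metric.closedBall_mem_nhds _ (by simp)
  · refine Set.Finite.of_finite_image ?_ (Set.injOn_of_injective Subtype.val_injective)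
    refine ((aux_finite P Δ hdisc 1).image (fun x a => (x a).1)).subset ?_
    rintro _ ⟨⟨y, hy⟩, h, rfl⟩
    obtain ⟨x, hx, h1, h2⟩ := (mem_auxL P Δ y).1 hy
    refine ⟨x, ⟨hx, aux_norm_le P x 1 le_rfl (fun a => ?_) h1⟩, funext fun a => (h2 a).symm⟩
    have h3 : ‖y‖ ≤ 1 := by simpa using h
    rw [← h2]
    exact (norm_le_pi_norm y a).trans h3

theorem auxL_span {d : ℕ} (Δ : Submodule ↥(ZSring P) (Fin d → QSring P))
    (hfull : Submodule.span (QSring P) (Δ : Set (Fin d → QSring P)) = ⊤) :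
    Submodule.span ℝ (auxL P Δ : Set (Fin d → ℝ)) = ⊤ := by
  have key : ∀ x ∈ Submodule.span (QSring P) (Δ : Set (Fin d → QSring P)),
      (fun a => (x a).1) ∈ Submodule.span ℝ (auxL P Δ : Set (Fin d → ℝ)) := by
    intro x hx
    induction hx using Submodule.span_induction with
    | mem x hx =>
      obtain ⟨n, hn⟩ := aux_scale P x
      have hmem : (fun a => ((diagQ P ((((∏ i, P i : ℕ) : ℚ)) ^ n) • x) a).1) ∈ auxL P Δ :=
        ⟨_, aux_smul_mem P Δ _ (pow_mem (natCast_mem _ _) n) x hx, hn, fun a => rfl⟩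
      have h0 := aux_prod_ne P
      have e : (fun a => (x a).1) = ((((∏ i, P i : ℕ) : ℚ) ^ n : ℚ) : ℝ)⁻¹ •
          (fun a => ((diagQ P ((((∏ i, P i : ℕ) : ℚ)) ^ n) • x) a).1) := by
        ext a
        have h0' : ((((∏ i, P i : ℕ) : ℚ) ^ n : ℚ) : ℝ) ≠ 0 := by
          exact_mod_cast pow_ne_zero n h0
        simp only [Pi.smul_apply, smul_eq_mul, Prod.fst_mul]
        change _ = _⁻¹ * (((((∏ i, P i : ℕ) : ℚ) ^ n : ℚ) : ℝ) * _)
        rw [inv_mul_cancel_left₀ h0']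
      rw [e]
      exact Submodule.smul_mem _ _ (Submodule.subset_span hmem)
    | zero => exact Submodule.zero_mem _
    | add x y _ _ hx hy => exact Submodule.add_mem _ hx hy
    | smul c x _ hx => exact Submodule.smul_mem _ c.1 hx
  rw [eq_top_iff]
  intro y _
  exact key (fun a => (y a, 0)) (by rw [hfull]; trivial)

theorem aux_struct {d : ℕ} (Δ : Submodule ↥(ZSring P) (Fin d → QSring P))
    (hdisc : DiscreteTopology Δ)
    (hfull : Submodule.span (QSring P) (Δ : Set (Fin d → QSring P)) = ⊤) :
    ∃ B h : Matrix (Fin d) (Fin d) (QSring P), B * h = 1 ∧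
      ∀ x ∈ Δ, ∃ q : Fin d → ℚ, (∀ j, q j ∈ ZQ P) ∧
        x = Matrix.vecMul (fun j => diagQ P (q j)) B := by
  have h1 := auxL_discrete P Δ hdisc
  have h2 : IsZLattice ℝ (auxL P Δ) := ⟨auxL_span P Δ hfull⟩
  let b := IsZLattice.basis (auxL P Δ)
  have h3 : ∀ j, ∃ x ∈ Δ, (∀ a t, ‖(x a).2 t‖ ≤ 1) ∧ ∀ a, (b j : Fin d → ℝ) a = (x a).1 :=
    fun j => (mem_auxL P Δ _).1 (b j).2
  choose B hB hBi hBr using h3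
  have hcoord : ∀ x ∈ Δ, ∃ q : Fin d → ℚ, (∀ j, q j ∈ ZQ P) ∧
        x = Matrix.vecMul (fun j => diagQ P (q j)) B := by
    intro x hx
    obtain ⟨n, hn⟩ := aux_scale P x
    have h0 := pow_ne_zero n (aux_prod_ne P)
    have hxm := aux_smul_mem P Δ _ (pow_mem (natCast_mem (ZQ P) (∏ i, P i)) n) x hx
    set x' := diagQ P ((((∏ i, P i : ℕ) : ℚ)) ^ n) • x with hx'
    have hmem : (fun a => (x' a).1) ∈ auxL P Δ := ⟨_, hxm, hn, fun a => rfl⟩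
    let z : Fin d → ℤ := fun j => b.repr ⟨_, hmem⟩ j
    have hz : ∀ a, (x' a).1 = ∑ j, (z j : ℝ) * (B j a).1 := by
      intro a
      have e := congrArg (fun y : auxL P Δ => (y : Fin d → ℝ) a) (b.sum_repr ⟨_, hmem⟩)
      simp only [Submodule.coe_sum, Finset.sum_apply, Submodule.coe_smul, Pi.smul_apply] at e
      rw [← e]
      refine Finset.sum_congr rfl fun j _ => ?_
      rw [← hBr, zsmul_eq_mul]
    have hzero : x' - ∑ j, z j • B j = 0 := by
      refine aux_ker P Δ hdisc _ (Δ.sub_mem hxm (Δ.sum_mem fun j _ => Δ.toAddSubgroup.zsmul_mem (hB j) _)) ?_ ?_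
      · intro a
        simp [hz, Prod.fst_sum]
      · intro a t
        have e : ((x' - ∑ j, z j • B j) a).2 t = (x' a).2 t - ∑ j, (z j : ℚ_[P t]) * (B j a).2 t := by
          simp [Prod.snd_sum]
        rw [e, sub_eq_add_neg]
        refine (Padic.nonarchimedean _ _).trans (max_le (hn a t) ?_)
        rw [norm_neg]
        refine IsUltrametricDist.norm_sum_le_of_forall_le_of_nonneg zero_le_one fun j _ => ?_
        rw [norm_mul]
        exact mul_le_one₀ (Padic.norm_int_le_one _) (norm_nonneg _) (hBi j a t)
    refine ⟨fun j => ((((∏ i, P i : ℕ) : ℚ))⁻¹) ^ n * z j, fun j => mul_mem (pow_mem (aux_inv_mem P) _) (intCast_mem _ _), ?_⟩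
    have e1 : x = diagQ P (((((∏ i, P i : ℕ) : ℚ))⁻¹) ^ n) • x' := by
      rw [hx', smul_smul, ← map_mul, ← mul_pow, inv_mul_cancel₀ (aux_prod_ne P), one_pow, map_one, one_smul]
    rw [sub_eq_zero] at hzero
    rw [e1, hzero]
    ext1 a
    simp only [Pi.smul_apply, Finset.sum_apply, Matrix.vecMul, dotProduct, smul_eq_mul, Finset.mul_sum, map_mul, map_intCast,
      zsmul_eq_mul, mul_assoc]
    rfl
  have hspan : Submodule.span (QSring P) (Set.range B) = ⊤ := by
    rw [eq_top_iff, ← hfull, Submodule.span_le]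
    intro x hx
    obtain ⟨q, _, hq⟩ := hcoord x hx
    rw [hq]
    rw [SetLike.mem_coe, Submodule.mem_span_range_iff_exists_fun]
    refine ⟨fun j => diagQ P (q j), ?_⟩
    ext1 a
    simp [Matrix.vecMul, dotProduct]
  have hinv : ∀ i : Fin d, ∃ c : Fin d → QSring P, ∑ j, c j • B j = Pi.single i 1 := by
    intro i
    rw [← Submodule.mem_span_range_iff_exists_fun, hspan]
    trivial
  choose h hh using hinv
  refine ⟨Matrix.of B, Matrix.of h, ?_, hcoord⟩
  refine mul_eq_one_comm.1 ?_
  ext1 i a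
  have := congrFun (hh i) a
  simp only [Finset.sum_apply, Pi.smul_apply, smul_eq_mul] at this
  rw [Matrix.mul_apply]
  refine this.trans ?_
  simp [Matrix.one_apply, Pi.single_apply, eq_comm]

theorem aux_inj {d : ℕ} (a₀ : Fin d) (Δ : Submodule ↥(ZSring P) (Fin d → QSring P))
    (hcocompact : ∃ C : Set (Fin d → QSring P), IsCompact C ∧ ∀ x, ∃ y ∈ Δ, x - y ∈ C)
    (B h : Matrix (Fin d) (Fin d) (QSring P)) (hBh : B * h = 1)
    (hc : ∀ x ∈ Δ, ∃ q : Fin d → ℚ, (∀ j, q j ∈ ZQ P) ∧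
        x = Matrix.vecMul (fun j => diagQ P (q j)) B) : Function.Injective P := by
  intro i j hij
  by_contra hne
  obtain ⟨C, hC, hCov⟩ := hcocompact
  have hcont : Continuous (fun x : Fin d → QSring P => Matrix.vecMul x h a₀) := by
    simp only [Matrix.vecMul, dotProduct]
    fun_prop
  obtain ⟨R, hR⟩ := hC.exists_bound_of_continuousOn hcont.continuousOn
  have hp : (1 : ℝ) < P i := Nat.one_lt_cast.2 (Fact.out : (P i).Prime).one_lt
  obtain ⟨n, hn⟩ := pow_unbounded_of_one_lt (2 * R) hp
  let ξ : QSring P := (0, Pi.single i ((((P i : ℕ) : ℚ_[P i])⁻¹) ^ n))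
  obtain ⟨y, hy, hyC⟩ := hCov (Matrix.vecMul (Pi.single a₀ ξ) B)
  obtain ⟨q, -, hq⟩ := hc y hy
  have h1 := hR _ hyC
  rw [hq, ← Matrix.sub_vecMul, Matrix.vecMul_vecMul, hBh, Matrix.vecMul_one] at h1
  simp only [Pi.sub_apply, Pi.single_eq_same] at h1
  have h2 : ∀ t, ‖ξ.2 t - (q a₀ : ℚ_[P t])‖ ≤ R := fun t =>
    (norm_le_pi_norm (ξ - diagQ P (q a₀)).2 t).trans ((norm_snd_le _).trans h1)
  have hi := h2 i
  have hj := h2 j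
  have e1 : ξ.2 i = (((P i : ℕ) : ℚ_[P i])⁻¹) ^ n := by simp [ξ]
  have e2 : ξ.2 j = 0 := by simp [ξ, Ne.symm hne]
  rw [e1] at hi
  rw [e2, zero_sub, norm_neg] at hj
  have e3 : ‖(q a₀ : ℚ_[P j])‖ = ‖(q a₀ : ℚ_[P i])‖ := by
    rw [Padic.eq_padicNorm, Padic.eq_padicNorm, hij]
  rw [e3] at hj
  have e4 : ‖(((P i : ℕ) : ℚ_[P i])⁻¹) ^ n‖ = (P i : ℝ) ^ n := by
    rw [norm_pow, norm_inv, Padic.norm_p, inv_inv]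
  have e5 := norm_add_le ((((P i : ℕ) : ℚ_[P i])⁻¹) ^ n - (q a₀ : ℚ_[P i])) (q a₀ : ℚ_[P i])
  rw [sub_add_cancel, e4] at e5
  linarith

theorem aux_bound {F : Type*} [NormedField F] {k d : ℕ} (U V : Matrix (Fin k) (Fin d) F)
    (H : Matrix (Fin d) (Fin d) F) (hU : U = V * H) (M : ℝ)
    (hM : ∀ g : Fin k → Fin d, ‖(V.submatrix id g).det‖ ≤ M) (f : Fin k → Fin d) :
    ‖(U.submatrix id f).det‖ ≤
      (∑ f : Fin k → Fin d, ∑ g : Fin k → Fin d, ‖∏ i, H (g i) (f i)‖) * M := by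
  have hM0 : 0 ≤ M := (norm_nonneg _).trans (hM f)
  have e : U.submatrix id f = V * H.submatrix id f := by
    rw [hU]; rfl
  rw [e, aux_det_mul]
  refine (norm_sum_le _ _).trans ?_
  have : (∑ g : Fin k → Fin d, ‖∏ i, H (g i) (f i)‖) * M ≤
      (∑ f : Fin k → Fin d, ∑ g : Fin k → Fin d, ‖∏ i, H (g i) (f i)‖) * M := by
    refine mul_le_mul_of_nonneg_right ?_ hM0
    exact Finset.single_le_sum (f := fun f : Fin k → Fin d => ∑ g : Fin k → Fin d, ‖∏ i, H (g i) (f i)‖)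
      (fun f _ => Finset.sum_nonneg fun g _ => norm_nonneg _) (Finset.mem_univ f)
  refine le_trans ?_ this
  rw [Finset.sum_mul]
  refine Finset.sum_le_sum fun g _ => ?_
  rw [norm_mul]
  exact mul_le_mul_of_nonneg_left (hM g) (norm_nonneg _)

theorem aux_covol {d : ℕ} (B h : Matrix (Fin d) (Fin d) (QSring P)) (hBh : B * h = 1) (k : ℕ) :
    ∃ C : ℝ, ∀ (v : Fin k → Fin d → QSring P) (u : Matrix (Fin k) (Fin d) ℚ),
      (∀ r, v r = Matrix.vecMul (fun j => diagQ P (u r j)) B) → covolOfBasis P v < 1 →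
      ∃ (A : ℝ) (a : Fin s → ℝ),
        (∀ f : Fin k → Fin d, |(((u.submatrix id f).det : ℚ) : ℝ)| ≤ A) ∧
        (∀ t, ∀ f : Fin k → Fin d, ‖(((u.submatrix id f).det : ℚ) : ℚ_[P t])‖ ≤ a t) ∧
        A * ∏ t, a t ≤ C := by
  let K0 : ℝ := ∑ f : Fin k → Fin d, ∑ g : Fin k → Fin d, ‖∏ i, (h (g i) (f i)).1‖
  let K : Fin s → ℝ := fun t => ∑ f : Fin k → Fin d, ∑ g : Fin k → Fin d, ‖∏ i, (h (g i) (f i)).2 t‖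
  have hK0 : 0 ≤ K0 := Finset.sum_nonneg fun f _ => Finset.sum_nonneg fun g _ => norm_nonneg _
  have hK : ∀ t, 0 ≤ K t := fun t => Finset.sum_nonneg fun f _ => Finset.sum_nonneg fun g _ => norm_nonneg _
  refine ⟨K0 * Real.sqrt (k.factorial) * ∏ t, K t, ?_⟩
  intro v u hv hcov
  have hVU : Matrix.of v = u.map (diagQ P) * B := by
    ext1 r a
    exact congrFun (hv r) a
  have hUV : u.map (diagQ P) = Matrix.of v * h := by
    rw [hVU, Matrix.mul_assoc, hBh, Matrix.mul_one]
  let V0 : Matrix (Fin k) (Fin d) ℝ := Matrix.of fun r a => (v r a).1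
  let V : ∀ t, Matrix (Fin k) (Fin d) ℚ_[P t] := fun t => Matrix.of fun r a => (v r a).2 t
  have hUV0 : u.map (Rat.castHom ℝ) = V0 * (h.map fun x => x.1) := by
    ext1 r a
    have := congrArg (fun x : QSring P => x.1) (congrFun (congrFun hUV r) a)
    simp only [Matrix.mul_apply, Prod.fst_sum, Prod.fst_mul] at this
    exact this
  have hUVt : ∀ t, u.map (Rat.castHom ℚ_[P t]) = V t * (h.map fun x => x.2 t) := by
    intro t
    ext1 r a
    have := congrArg (fun x : QSring P => x.2 t) (congrFun (congrFun hUV r) a)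
    simp only [Matrix.mul_apply, Prod.snd_sum, Prod.snd_mul, Finset.sum_apply, Pi.mul_apply] at this
    exact this
  have hG : ∀ g : Fin k → Fin d, ‖(V0.submatrix id g).det‖ ≤
      Real.sqrt (k.factorial) * Real.sqrt (V0 * V0.transpose).det := by
    intro g
    rw [← Real.sqrt_mul (Nat.cast_nonneg _), aux_gram, Real.norm_eq_abs, ← Real.sqrt_sq_eq_abs]
    refine Real.sqrt_le_sqrt ?_
    exact Finset.single_le_sum (f := fun f : Fin k → Fin d => (V0.submatrix id f).det ^ 2)
      (fun f _ => sq_nonneg _) (Finset.mem_univ g)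
  let N : Fin s → ℝ := fun t => ((Finset.univ.sup fun e : Fin k ↪ Fin d =>
        ‖Matrix.det (Matrix.of fun r c : Fin k => (v r (e c)).2 t)‖₊ : NNReal) : ℝ)
  have hN : ∀ t, ∀ g : Fin k → Fin d, ‖((V t).submatrix id g).det‖ ≤ N t := by
    intro t g
    by_cases hg : Function.Injective g
    · exact NNReal.coe_le_coe.2 (Finset.le_sup (f := fun e : Fin k ↪ Fin d =>
        ‖Matrix.det (Matrix.of fun r c : Fin k => (v r (e c)).2 t)‖₊) (Finset.mem_univ (⟨g, hg⟩ : Fin k ↪ Fin d)))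
    · have : ((V t).submatrix id g).det = 0 := by
        simp only [Function.Injective, not_forall] at hg
        obtain ⟨a, b, hab, hne⟩ := hg
        exact Matrix.det_zero_of_column_eq hne fun r => by simp [hab]
      rw [this, norm_zero]
      exact NNReal.coe_nonneg _
  have hcov' : Real.sqrt (V0 * V0.transpose).det * ∏ t, N t < 1 := hcov
  refine ⟨K0 * (Real.sqrt (k.factorial) * Real.sqrt (V0 * V0.transpose).det), fun t => K t * N t, ?_, ?_, ?_⟩
  · intro f
    have := aux_bound _ _ _ hUV0 _ hG f
    rw [Matrix.submatrix_map, ← RingHom.mapMatrix_apply, ← RingHom.map_det] at this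
    exact this
  · intro t f
    have := aux_bound _ _ _ (hUVt t) _ (hN t) f
    rw [Matrix.submatrix_map, ← RingHom.mapMatrix_apply, ← RingHom.map_det] at this
    exact this
  · rw [Finset.prod_mul_distrib]
    have h0 : 0 ≤ K0 * Real.sqrt (k.factorial) * ∏ t, K t :=
      mul_nonneg (mul_nonneg hK0 (Real.sqrt_nonneg _)) (Finset.prod_nonneg fun t _ => hK t)
    calc _ = (K0 * Real.sqrt (k.factorial) * ∏ t, K t) * (Real.sqrt (V0 * V0.transpose).det * ∏ t, N t) := by ring
      _ ≤ _ := mul_le_of_le_one_right h0 hcov'.le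

/-- Parametrization of submodules. -/
def auxF {d : ℕ} (B : Matrix (Fin d) (Fin d) (QSring P)) {k : ℕ} (e : Fin k → Fin d)
    (w : (Fin k → Fin d) → ℤ) (T : Set (Fin k → ZMod (w e).natAbs)) : Set (Fin d → QSring P) :=
  {y | ∃ x : Fin k → ℚ, (∃ (n : ℕ) (z : Fin k → ℤ),
      (∀ i, (((∏ i, P i : ℕ) : ℚ)) ^ n * x i = z i) ∧ (fun i => (z i : ZMod (w e).natAbs)) ∈ T) ∧
      y = Matrix.vecMul (fun j => diagQ P (∑ i, x i * ((w (Function.update e i j) : ℚ) / (w e : ℚ)))) B}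

theorem aux_mem_span {d k : ℕ} (B : Matrix (Fin d) (Fin d) (QSring P))
    (v : Fin k → Fin d → QSring P) (u : Matrix (Fin k) (Fin d) ℚ)
    (hv : ∀ r, v r = Matrix.vecMul (fun j => diagQ P (u r j)) B) (y : Fin d → QSring P) :
    y ∈ Submodule.span ↥(ZSring P) (Set.range v) ↔
      ∃ c : Fin k → ℚ, (∀ r, c r ∈ ZQ P) ∧ y = Matrix.vecMul (fun j => diagQ P (∑ r, c r * u r j)) B := by
  have key : ∀ c : Fin k → ℚ, ∑ r, diagQ P (c r) • v r =
      Matrix.vecMul (fun j => diagQ P (∑ r, c r * u r j)) B := by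
    intro c
    ext1 a
    simp only [Finset.sum_apply, Pi.smul_apply, hv, Matrix.vecMul, dotProduct, smul_eq_mul, map_sum, map_mul,
      Finset.sum_mul, Finset.mul_sum]
    rw [Finset.sum_comm]
    simp only [mul_assoc]
  rw [Submodule.mem_span_range_iff_exists_fun]
  constructor
  · rintro ⟨c, rfl⟩
    choose c' hc' hcc' using fun r => (c r).2
    refine ⟨c', hc', ?_⟩
    rw [← key]
    refine Finset.sum_congr rfl fun r _ => ?_
    rw [hcc']
    rfl
  · rintro ⟨c, hc, rfl⟩
    refine ⟨fun r => ⟨diagQ P (c r), ⟨c r, hc r, rfl⟩⟩, ?_⟩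
    rw [← key]
    rfl

theorem aux_param {d k : ℕ} (B : Matrix (Fin d) (Fin d) (QSring P))
    (v : Fin k → Fin d → QSring P) (u : Matrix (Fin k) (Fin d) ℚ) (hu : ∀ r j, u r j ∈ ZQ P)
    (hv : ∀ r, v r = Matrix.vecMul (fun j => diagQ P (u r j)) B)
    (e : Fin k → Fin d) (he : (u.submatrix id e).det ≠ 0)
    (q : ℚ) (hq : q ∈ ZQ P) (hq0 : q ≠ 0) (w : (Fin k → Fin d) → ℤ)
    (hw : ∀ f, q * (u.submatrix id f).det = w f) :
    ∃ T, (Submodule.span ↥(ZSring P) (Set.range v) : Set (Fin d → QSring P)) = auxF P B e w T := by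
  have hm := aux_prod_ne P
  set m : ℚ := ((∏ i, P i : ℕ) : ℚ) with hmdef
  have hwe : (w e : ℚ) ≠ 0 := by rw [← hw]; exact mul_ne_zero hq0 he
  -- the row lattice
  let L : (Fin k → ℚ) → Prop := fun x => ∃ c : Fin k → ℚ, (∀ r, c r ∈ ZQ P) ∧ ∀ i, x i = ∑ r, c r * u r (e i)
  have hLadd : ∀ x y, L x → L y → L (x + y) := by
    rintro x y ⟨c, hc, hx⟩ ⟨c', hc', hy⟩
    refine ⟨c + c', fun r => add_mem (hc r) (hc' r), fun i => ?_⟩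
    simp [hx, hy, add_mul, Finset.sum_add_distrib]
  have hLsmul : ∀ a ∈ ZQ P, ∀ x, L x → L (fun i => a * x i) := by
    rintro a ha x ⟨c, hc, hx⟩
    refine ⟨fun r => a * c r, fun r => mul_mem ha (hc r), fun i => ?_⟩
    simp [hx, Finset.mul_sum, mul_assoc]
  have hLN : ∀ z : Fin k → ℤ, L (fun i => (w e : ℚ) * z i) := by
    intro z
    have hdet : ∀ M : Matrix (Fin k) (Fin k) ℚ, (∀ i j, M i j ∈ ZQ P) → M.det ∈ ZQ P := by
      intro M hM
      rw [Matrix.det_apply']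
      exact sum_mem fun σ _ => mul_mem (intCast_mem _ _) (prod_mem fun i _ => hM _ _)
    have hadj : ∀ i j, (u.submatrix id e).adjugate i j ∈ ZQ P := by
      intro i j
      rw [Matrix.adjugate_apply]
      refine hdet _ fun a b => ?_
      rw [Matrix.updateRow_apply]
      split_ifs
      · rw [Pi.single_apply]
        split_ifs
        · exact one_mem _
        · exact zero_mem _
      · exact hu _ _
    refine ⟨fun r => q * ∑ i, (z i : ℚ) * (u.submatrix id e).adjugate i r, fun r => mul_mem hq
      (sum_mem fun i _ => mul_mem (intCast_mem _ _) (hadj i r)), fun i => ?_⟩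
    have h1 := congrFun (congrArg (Matrix.vecMul (fun i => (z i : ℚ))) (Matrix.adjugate_mul (u.submatrix id e))) i
    rw [← Matrix.vecMul_vecMul, Matrix.vecMul_smul, Matrix.vecMul_one] at h1
    simp only [Pi.smul_apply, smul_eq_mul] at h1
    change (w e : ℚ) * (z i : ℚ) = ∑ r, (q * ∑ i, (z i : ℚ) * (u.submatrix id e).adjugate i r) * u r (e i)
    rw [← hw, mul_assoc, ← h1]
    simp only [Matrix.vecMul, dotProduct, Finset.mul_sum, Matrix.submatrix_apply, id, mul_assoc]
    refine Finset.sum_congr rfl fun r _ => ?_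
    simp only [Finset.sum_mul, Finset.mul_sum, mul_assoc]
  have hcr : ∀ r j, u r j = ∑ i, u r (e i) * ((w (Function.update e i j) : ℚ) / (w e : ℚ)) := by
    intro r j
    have h1 := aux_cramer u e r j
    have h2 : (w e : ℚ) * u r j = ∑ i, u r (e i) * (w (Function.update e i j) : ℚ) := by
      rw [← hw, mul_assoc, h1, Finset.mul_sum]
      refine Finset.sum_congr rfl fun i _ => ?_
      rw [← hw]; ring
    rw [eq_comm, ← mul_right_inj' hwe, h2, Finset.mul_sum]
    refine Finset.sum_congr rfl fun i _ => ?_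
    field_simp
  have hcoef : ∀ (c x : Fin k → ℚ), (∀ i, x i = ∑ r, c r * u r (e i)) → ∀ j,
      ∑ r, c r * u r j = ∑ i, x i * ((w (Function.update e i j) : ℚ) / (w e : ℚ)) := by
    intro c x hx j
    simp only [hx, Finset.sum_mul]
    rw [Finset.sum_comm]
    refine Finset.sum_congr rfl fun r _ => ?_
    rw [hcr r j, Finset.mul_sum]
    refine Finset.sum_congr rfl fun i _ => by ring
  refine ⟨{τ | ∃ z : Fin k → ℤ, L (fun i => (z i : ℚ)) ∧ τ = fun i => (z i : ZMod (w e).natAbs)}, ?_⟩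
  ext y
  rw [SetLike.mem_coe, aux_mem_span P B v u hv]
  constructor
  · rintro ⟨c, hc, rfl⟩
    have hLx : L (fun i => ∑ r, c r * u r (e i)) := ⟨c, hc, fun i => rfl⟩
    refine ⟨fun i => ∑ r, c r * u r (e i), ?_, ?_⟩
    · have hx : ∀ i, (∑ r, c r * u r (e i)) ∈ ZQ P := fun i => sum_mem fun r _ => mul_mem (hc r) (hu _ _)
      choose n z hz using fun i => aux_den P _ (hx i)
      let M := Finset.univ.sup n
      have hnM : ∀ i, n i ≤ M := fun i => Finset.le_sup (Finset.mem_univ i)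
      have hz' : ∀ i, m ^ M * (∑ r, c r * u r (e i)) =
          ((((∏ i, P i : ℕ) : ℤ) ^ (M - n i) * z i : ℤ) : ℚ) := by
        intro i
        rw [Int.cast_mul, ← hz, ← mul_assoc]
        congr 1
        push_cast
        rw [← pow_add, Nat.sub_add_cancel (hnM i)]
        simp [hmdef]
      refine ⟨M, _, hz', _, ?_, rfl⟩
      have := hLsmul (m ^ M) (pow_mem (natCast_mem _ _) _) _ hLx
      simp only [hz'] at this
      exact this
    · congr 1
      funext j
      rw [hcoef c _ (fun i => rfl) j]
  · rintro ⟨x, ⟨n, z, hz, z', hz', hzz'⟩, rfl⟩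
    have hcong : ∀ i, ∃ b : ℤ, z i = z' i + w e * b := by
      intro i
      have h1 := congrFun hzz' i
      rw [eq_comm, ZMod.intCast_eq_intCast_iff_dvd_sub] at h1
      obtain ⟨b, hb⟩ := (Int.natAbs_dvd.1 h1)
      exact ⟨b, by rw [← hb]; ring⟩
    choose b hb using hcong
    have hLz : L (fun i => (z i : ℚ)) := by
      have := hLadd _ _ hz' (hLN b)
      convert this using 1
      funext i
      simp [hb]
    have hLx : L x := by
      have := hLsmul (m⁻¹ ^ n) (pow_mem (aux_inv_mem P) _) _ hLz
      convert this using 1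
      funext i
      rw [← hz, ← mul_assoc, ← mul_pow, inv_mul_cancel₀ hm, one_pow, one_mul]
    obtain ⟨c, hc, hx⟩ := hLx
    refine ⟨c, hc, ?_⟩
    congr 1
    funext j
    rw [hcoef c x hx j]

theorem aux_indep {d k : ℕ} (B h : Matrix (Fin d) (Fin d) (QSring P))
    (v : Fin k → Fin d → QSring P) (u : Matrix (Fin k) (Fin d) ℚ)
    (hv : ∀ r, v r = Matrix.vecMul (fun j => diagQ P (u r j)) B)
    (hli : LinearIndependent ↥(ZSring P) v) (c : Fin k → ℚ) (hc : Matrix.vecMul c u = 0) : c = 0 := by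
  obtain ⟨D, hD⟩ := IsLocalization.exist_integer_multiples_of_finite (nonZeroDivisors ℤ) c
  have hD0 : ((D : ℤ) : ℚ) ≠ 0 := Int.cast_ne_zero.2 (nonZeroDivisors.coe_ne_zero D)
  have hmem : ∀ r, ((D : ℤ) : ℚ) * c r ∈ ZQ P := by
    intro r
    obtain ⟨z, hz⟩ := hD r
    rw [zsmul_eq_mul] at hz
    rw [← hz]
    exact intCast_mem _ z
  rw [Fintype.linearIndependent_iff] at hli
  have h1 := hli (fun r => ⟨diagQ P (((D : ℤ) : ℚ) * c r), ⟨_, hmem r, rfl⟩⟩) ?_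
  · funext r
    have h2 := congrArg Subtype.val (h1 r)
    have h3 : diagQ P (((D : ℤ) : ℚ) * c r) = 0 := h2
    rw [map_eq_zero_iff _ (diagQ P).injective] at h3
    exact (mul_eq_zero.1 h3).resolve_left hD0
  · change ∑ r, diagQ P (((D : ℤ) : ℚ) * c r) • v r = 0
    have h4 : ∀ j, ∑ r, c r * u r j = 0 := fun j => congrFun hc j
    ext1 a
    simp only [Finset.sum_apply, Pi.smul_apply, hv, Matrix.vecMul, dotProduct, smul_eq_mul, Finset.mul_sum, Pi.zero_apply]
    rw [Finset.sum_comm]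
    refine Finset.sum_eq_zero fun j _ => ?_
    have : ∑ r, diagQ P (((D : ℤ) : ℚ) * c r) * (diagQ P (u r j) * B j a) =
        diagQ P (((D : ℤ) : ℚ) * ∑ r, c r * u r j) * B j a := by
      simp only [map_mul, map_sum, Finset.sum_mul, Finset.mul_sum, mul_assoc]
    rw [this, h4]
    simp

/-- Let `Δ` be a lattice (a discrete, cocompact `ℤ_S`-submodule of full rank) in `ℚ_S^d`.
Then the set of nonzero `ℤ_S`-submodules of `Δ` of covolume strictly less than `1` is finite.
(A submodule has covolume `< 1` iff it admits a `ℤ_S`-basis whose covolume formula is `< 1`.) -/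
theorem finitely_many_small_covolume_submodules {d : ℕ}
    (Δ : Submodule ↥(ZSring P) (Fin d → QSring P))
    (hdisc : DiscreteTopology Δ)
    (hcocompact : ∃ C : Set (Fin d → QSring P), IsCompact C ∧ ∀ x, ∃ y ∈ Δ, x - y ∈ C)
    (hfull : Submodule.span (QSring P) (Δ : Set (Fin d → QSring P)) = ⊤) :
    {Δ' : Submodule ↥(ZSring P) (Fin d → QSring P) |
        Δ' ≤ Δ ∧ Δ' ≠ ⊥ ∧
        ∃ (k : ℕ) (v : Fin k → (Fin d → QSring P)),
          LinearIndependent ↥(ZSring P) v ∧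
          Submodule.span ↥(ZSring P) (Set.range v) = Δ' ∧
          covolOfBasis P v < 1}.Finite := by
  obtain ⟨B, h, hBh, hcoord⟩ := aux_struct P Δ hdisc hfull
  rcases Nat.eq_zero_or_pos d with hd | hd
  · subst hd
    refine Set.Finite.subset (Set.finite_empty) ?_
    rintro Δ' ⟨-, hne, -⟩
    exact hne (Submodule.eq_bot_of_subsingleton)
  have hP := aux_inj P ⟨0, hd⟩ Δ hcocompact B h hBh hcoord
  choose C hC using aux_covol P B h hBh
  refine Set.Finite.of_finite_image ?_ (Set.injOn_of_injective (SetLike.coe_injective))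
  have hfin : (⋃ k ∈ Set.Iic d, ⋃ e : Fin k → Fin d,
      ⋃ w ∈ {w : (Fin k → Fin d) → ℤ | w e ≠ 0 ∧ ∀ f, w f ∈ Set.Icc (-⌈C k⌉) ⌈C k⌉},
        Set.range (auxF P B e w)).Finite := by
    refine (Set.finite_Iic d).biUnion fun k _ => ?_
    refine Set.finite_iUnion fun e => ?_
    refine Set.Finite.biUnion ?_ fun w hw => ?_
    · refine (Set.Finite.pi (fun f : Fin k → Fin d => Set.finite_Icc (-⌈C k⌉) ⌈C k⌉)).subset ?_
      rintro w ⟨-, hw⟩ f -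
      exact hw f
    · have : NeZero (w e).natAbs := ⟨Int.natAbs_ne_zero.2 hw.1⟩
      exact Set.finite_range _
  refine hfin.subset ?_
  rintro _ ⟨Δ', ⟨hle, -, k, v, hli, hspan, hcov⟩, rfl⟩
  have hvΔ : ∀ r, v r ∈ Δ := fun r => hle (hspan ▸ Submodule.subset_span ⟨r, rfl⟩)
  choose u hu huv using fun r => hcoord (v r) (hvΔ r)
  obtain ⟨A, a, hA, ha, hAC⟩ := hC k v (Matrix.of u) huv hcov
  obtain ⟨e, he⟩ := aux_exists_minor (Matrix.of u) (aux_indep P B h v (Matrix.of u) huv hli)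
  have hdet : ∀ f : Fin k → Fin d, ((Matrix.of u).submatrix id f).det ∈ ZQ P := by
    intro f
    rw [Matrix.det_apply']
    exact sum_mem fun σ _ => mul_mem (intCast_mem _ _) (prod_mem fun i _ => hu _ _)
  obtain ⟨q, hq, hq0, w, hw, hwC⟩ := aux_height P hP _ hdet e he A a (C k) hA ha hAC
  obtain ⟨T, hT⟩ := aux_param P B v (Matrix.of u) hu huv e he q hq hq0 w hw
  have hinj : Function.Injective e := by
    intro i j hij
    by_contra hne
    exact he (Matrix.det_zero_of_column_eq hne fun r => by simp [hij])
  have hk : k ≤ d := by simpa using Fintype.card_le_of_injective e hinj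
  simp only [Set.mem_iUnion]
  refine ⟨k, hk, e, w, ⟨?_, fun f => ?_⟩, T, ?_⟩
  · have : (w e : ℚ) ≠ 0 := by rw [← hw]; exact mul_ne_zero hq0 he
    exact_mod_cast this
  · have := abs_le.1 ((hwC f).trans (Int.le_ceil (C k)))
    constructor
    · exact_mod_cast this.1
    · exact_mod_cast this.2
  · rw [← hT, hspan]
end
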